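/- arXiv:2104.11813 — 9 statements merged into one kernel-verified Lean document; each statement's English description precedes it below -/
import Mathlib

section
/- Let n ≥ 1 and let A be a real n×n matrix with positive diagonal entries and non-positive off-diagonal entries. Assume A is irreducible (for every pair of indices i ≠ j there exist indices i = i_0, i_1, …, i_r = j such that the entry A_{i_{k−1} i_k} is nonzero for k = 1, …, r), that every row sum of A is non-negative, and that at least one row sum of A is positive. Then A is nonsingular and every entry of A^{-1} is non-negative. -/
/-- If the minimum of `x` is a negative number attained at `i` and `(A *ᵥ x) i ≥ 0`, then row `i`
sums to zero and the minimum is attained at every `j` with `A i j ≠ 0`. -/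
lemma row_sum_eq_zero_and_eq_of_isMin {ι : Type*} [Fintype ι] {A : Matrix ι ι ℝ}
    (hoff : ∀ i j, i ≠ j → A i j ≤ 0) (hrow : ∀ i, 0 ≤ ∑ j, A i j) {x : ι → ℝ} {i : ι}
    (hAx : 0 ≤ (A.mulVec x) i) (hmin : ∀ j, x i ≤ x j) (hneg : x i < 0) :
    ∑ j, A i j = 0 ∧ ∀ j, A i j ≠ 0 → x j = x i := by
  have hsplit : (A.mulVec x) i = ∑ j, A i j * (x j - x i) + x i * ∑ j, A i j := by
    simp [Matrix.mulVec, dotProduct, mul_sub, ← Finset.sum_mul, mul_comm (x i)]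
  have hterm : ∀ j ∈ Finset.univ, A i j * (x j - x i) ≤ 0 := by
    intro j _
    rcases eq_or_ne i j with rfl | hij
    · simp
    · exact mul_nonpos_of_nonpos_of_nonneg (hoff i j hij) (sub_nonneg.2 (hmin j))
  have hsum := Finset.sum_nonpos hterm
  have hprod := mul_nonpos_of_nonpos_of_nonneg hneg.le (hrow i)
  have hsum_zero : ∑ j, A i j * (x j - x i) = 0 := by linarith
  have hprod_zero : x i * ∑ j, A i j = 0 := by linarith
  refine ⟨(mul_eq_zero.1 hprod_zero).resolve_left hneg.ne, fun j hj => ?_⟩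
  have hz := (Finset.sum_eq_zero_iff_of_nonpos hterm).1 hsum_zero j (Finset.mem_univ j)
  exact sub_eq_zero.1 ((mul_eq_zero.1 hz).resolve_left hj)

/-- The minimum principle: an irreducibly diagonally dominant matrix with non-positive
off-diagonal entries is monotone. -/
lemma nonneg_of_mulVec_nonneg {ι : Type*} [Fintype ι] {A : Matrix ι ι ℝ}
    (hoff : ∀ i j, i ≠ j → A i j ≤ 0)
    (hirr : ∀ i j, i ≠ j → Relation.TransGen (fun a b => A a b ≠ 0) i j)
    (hrow : ∀ i, 0 ≤ ∑ j, A i j) (hrowpos : ∃ i, 0 < ∑ j, A i j) {x : ι → ℝ}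
    (hAx : ∀ i, 0 ≤ (A.mulVec x) i) (i : ι) : 0 ≤ x i := by
  obtain ⟨p, hp⟩ := hrowpos
  have : Nonempty ι := ⟨p⟩
  obtain ⟨k, hk⟩ := Finite.exists_min x
  suffices 0 ≤ x k from this.trans (hk i)
  by_contra! hneg
  have hstep : ∀ j, x j = x k → ∑ l, A j l = 0 ∧ ∀ l, A j l ≠ 0 → x l = x j := fun j hj =>
    row_sum_eq_zero_and_eq_of_isMin hoff hrow (hAx j) (hj ▸ hk) (hj ▸ hneg)
  have hxp : x p = x k := by
    rcases eq_or_ne k p with rfl | hkp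
    · rfl
    · have hpath := hirr k p hkp
      clear hp hkp
      induction hpath with
      | single h => exact (hstep k rfl).2 _ h
      | tail _ h ih => exact ((hstep _ ih).2 _ h).trans ih
  exact hp.ne' (hstep p hxp).1


/-- Theorem 3.3 in the paper: a real square matrix with positive diagonal entries,
non-positive off-diagonal entries, which is irreducible, has non-negative row sums and
at least one positive row sum, is a nonsingular M-matrix, hence inverse-positive. -/
theorem mMatrix_of_irreducible_diagonally_dominant
    (n : ℕ) (hn : 1 ≤ n) (A : Matrix (Fin n) (Fin n) ℝ)
    (hdiag : ∀ i, 0 < A i i)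
    (hoff : ∀ i j, i ≠ j → A i j ≤ 0)
    (hirr : ∀ i j : Fin n, i ≠ j → Relation.TransGen (fun a b => A a b ≠ 0) i j)
    (hrow : ∀ i, 0 ≤ ∑ j, A i j)
    (hrowpos : ∃ i, 0 < ∑ j, A i j) :
    IsUnit A.det ∧ ∀ i j, 0 ≤ A⁻¹ i j := by
  have hmono {x : Fin n → ℝ} := nonneg_of_mulVec_nonneg hoff hirr hrow hrowpos (x := x)
  have hdet : IsUnit A.det := by
    rw [isUnit_iff_ne_zero]
    intro h
    obtain ⟨v, hv, hAv⟩ := Matrix.exists_mulVec_eq_zero_iff.2 h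
    refine hv (funext fun i => le_antisymm ?_ (hmono (by simp [hAv]) i))
    simpa using hmono (x := -v) (by simp [Matrix.mulVec_neg, hAv]) i
  refine ⟨hdet, fun i j => hmono (x := fun k => A⁻¹ k j) (fun l => ?_) i⟩
  change 0 ≤ (A * A⁻¹) l j
  rw [Matrix.mul_nonsing_inv A hdet, Matrix.one_apply]
  split_ifs <;> norm_num
end

section
/- Let n ≥ 1 and let A be a real n×n matrix with positive diagonal entries and non-positive off-diagonal entries. Then A is nonsingular with all entries of A^{-1} non-negative if and only if there exist positive real numbers d_1, …, d_n such that Σ_j A_{ij} d_j > 0 for every row i (i.e., there exists a positive diagonal matrix D such that all row sums of AD are positive). -/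
namespace Matrix

open scoped Matrix

variable {ι : Type*} [Fintype ι] {A : Matrix ι ι ℝ}

/-- A matrix with non-positive off-diagonal entries that maps some positive vector to a positive
vector is monotone: `0 ≤ A *ᵥ x` implies `0 ≤ x`. -/
theorem nonneg_of_mulVec_nonneg (hoff : ∀ i j, i ≠ j → A i j ≤ 0) {d : ι → ℝ}
    (hd : ∀ i, 0 < d i) (hAd : ∀ i, 0 < (A *ᵥ d) i) {x : ι → ℝ}
    (hx : ∀ i, 0 ≤ (A *ᵥ x) i) (k : ι) : 0 ≤ x k := by
  have : Nonempty ι := ⟨k⟩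
  obtain ⟨i, hi⟩ := Finite.exists_min fun j => x j / d j
  by_contra! hk
  have hneg : x i / d i < 0 := (hi k).trans_lt (div_neg_of_neg_of_pos hk (hd k))
  have hsub : (A *ᵥ (x - (x i / d i) • d)) i ≤ 0 := by
    refine Finset.sum_nonpos fun j _ => ?_
    obtain rfl | hij := eq_or_ne i j
    · simp [div_mul_cancel₀ _ (hd i).ne']
    · refine mul_nonpos_of_nonpos_of_nonneg (hoff i j hij) ?_
      simpa using (le_div_iff₀ (hd j)).1 (hi j)
  rw [mulVec_sub, mulVec_smul, Pi.sub_apply, Pi.smul_apply, smul_eq_mul] at hsub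
  linarith [hx i, mul_neg_of_neg_of_pos hneg (hAd i)]

variable [DecidableEq ι]

/-- A monotone matrix is inverse-positive. -/
theorem isUnit_det_and_inv_nonneg_of_monotone
    (hA : ∀ x : ι → ℝ, (∀ i, 0 ≤ (A *ᵥ x) i) → ∀ i, 0 ≤ x i) :
    IsUnit A.det ∧ ∀ i j, 0 ≤ A⁻¹ i j := by
  have hunit : IsUnit A.det := by
    rw [isUnit_iff_ne_zero, ne_eq, ← exists_mulVec_eq_zero_iff]
    rintro ⟨x, hx0, hx⟩
    refine hx0 (funext fun i => le_antisymm ?_ (hA x (by simp [hx]) i))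
    simpa using hA (-x) (by simp [mulVec_neg, hx]) i
  refine ⟨hunit, fun i j => hA (fun i => A⁻¹ i j) (fun k => ?_) i⟩
  change 0 ≤ (A * A⁻¹) k j
  rw [mul_nonsing_inv A hunit, one_apply]
  split_ifs <;> norm_num

/-- An inverse-positive matrix with non-positive off-diagonal entries maps some positive vector
to a positive vector. -/
theorem exists_pos_mulVec_pos_of_inv_nonneg (hoff : ∀ i j, i ≠ j → A i j ≤ 0)
    (hunit : IsUnit A.det) (hinv : ∀ i j, 0 ≤ A⁻¹ i j) :
    ∃ d : ι → ℝ, (∀ i, 0 < d i) ∧ ∀ i, 0 < (A *ᵥ d) i := by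
  have hA1 : A *ᵥ (A⁻¹ *ᵥ 1) = 1 := by
    rw [mulVec_mulVec, mul_nonsing_inv A hunit, one_mulVec]
  have hnonneg (i : ι) : 0 ≤ (A⁻¹ *ᵥ 1) i :=
    Finset.sum_nonneg fun j _ => mul_nonneg (hinv i j) zero_le_one
  refine ⟨A⁻¹ *ᵥ 1, fun i => (hnonneg i).lt_of_ne' fun hi => ?_, fun i => by simp [hA1]⟩
  have hle : (A *ᵥ (A⁻¹ *ᵥ 1)) i ≤ 0 := by
    refine Finset.sum_nonpos fun j _ => ?_
    obtain rfl | hij := eq_or_ne i j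
    · simp [hi]
    · exact mul_nonpos_of_nonpos_of_nonneg (hoff i j hij) (hnonneg j)
  rw [hA1, Pi.one_apply] at hle
  linarith

end Matrix

/-- Theorem 3.4 in the paper (condition K₃₅ of Plemmons): for a real square matrix with
positive diagonal entries and non-positive off-diagonal entries, the matrix is
inverse-positive (a nonsingular M-matrix) if and only if there exists a positive diagonal
matrix `D = diag d` such that all row sums of `A * D` are positive. -/
theorem mMatrix_iff_exists_positive_diagonal_scaling
    (n : ℕ) (hn : 1 ≤ n) (A : Matrix (Fin n) (Fin n) ℝ)
    (hdiag : ∀ i, 0 < A i i)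
    (hoff : ∀ i j, i ≠ j → A i j ≤ 0) :
    (IsUnit A.det ∧ ∀ i j, 0 ≤ A⁻¹ i j) ↔
      ∃ d : Fin n → ℝ, (∀ i, 0 < d i) ∧ ∀ i, 0 < ∑ j, A i j * d j :=
  ⟨fun ⟨hunit, hinv⟩ => Matrix.exists_pos_mulVec_pos_of_inv_nonneg hoff hunit hinv,
    fun ⟨_, hd, hAd⟩ => Matrix.isUnit_det_and_inv_nonneg_of_monotone fun _ hx =>
      Matrix.nonneg_of_mulVec_nonneg hoff hd hAd hx⟩
end

section
/- Let N ≥ 1 and let A be an invertible real N×N matrix such that every entry of A^{-1} is non-negative and A·𝟙 = 𝟙, where 𝟙 is the all-ones vector. If x, b ∈ ℝ^N satisfy A x = b, then for every index i, min_j b_j ≤ x_i ≤ max_j b_j (a discrete maximum principle). -/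
open Matrix

/-- A nonsingular matrix with entrywise non-negative inverse that fixes constant vectors has a
row-stochastic inverse. -/
theorem inv_mem_rowStochastic_of_inv_nonneg {n : Type*} [Fintype n] [DecidableEq n]
    {A : Matrix n n ℝ} (hinv : IsUnit A.det) (hpos : ∀ i j, 0 ≤ A⁻¹ i j)
    (hones : A *ᵥ 1 = 1) : A⁻¹ ∈ rowStochastic ℝ n := by
  refine mem_rowStochastic.2 ⟨hpos, ?_⟩
  conv_lhs => rw [← hones]
  rw [mulVec_mulVec, nonsing_inv_mul A hinv, one_mulVec]

/-- Theorem 3.2 in the paper: if `A` is invertible with entrywise non-negative inverse and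
`A 𝟙 = 𝟙`, then solutions of `A x = b` satisfy the discrete maximum principle
`min_j b_j ≤ x_i ≤ max_j b_j`. -/
theorem discrete_maximum_principle_of_inverse_positive
    (N : ℕ) (hN : 1 ≤ N) (A : Matrix (Fin N) (Fin N) ℝ)
    (hinv : IsUnit A.det)
    (hpos : ∀ i j, 0 ≤ A⁻¹ i j)
    (hones : A.mulVec (fun _ => (1 : ℝ)) = fun _ => (1 : ℝ))
    (x b : Fin N → ℝ) (hx : A.mulVec x = b) (i : Fin N) :
    Finset.univ.inf' ⟨⟨0, hN⟩, Finset.mem_univ _⟩ b ≤ x i ∧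
      x i ≤ Finset.univ.sup' ⟨⟨0, hN⟩, Finset.mem_univ _⟩ b := by
  have hP := inv_mem_rowStochastic_of_inv_nonneg hinv hpos hones
  have hsum : ∑ j, A⁻¹ i j = 1 := sum_row_of_mem_rowStochastic hP i
  have hxi : x i = ∑ j, A⁻¹ i j * b j := by
    rw [← hx]
    change x i = (A⁻¹ *ᵥ (A *ᵥ x)) i
    rw [mulVec_mulVec, nonsing_inv_mul A hinv, one_mulVec]
  have lower (m : ℝ) (hm : ∀ j, m ≤ b j) : m ≤ x i := by
    rw [hxi, ← one_mul m, ← hsum, Finset.sum_mul]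
    exact Finset.sum_le_sum fun j _ => mul_le_mul_of_nonneg_left (hm j) (hpos i j)
  have upper (M : ℝ) (hM : ∀ j, b j ≤ M) : x i ≤ M := by
    rw [hxi, ← one_mul M, ← hsum, Finset.sum_mul]
    exact Finset.sum_le_sum fun j _ => mul_le_mul_of_nonneg_left (hM j) (hpos i j)
  exact ⟨lower _ fun j => Finset.inf'_le b (Finset.mem_univ j),
    upper _ fun j => Finset.le_sup' b (Finset.mem_univ j)⟩
end

section
/- Let β > 0, Δt > 0, ε > 0, and let g : ℝ → ℝ be differentiable on [−β, β] with g(−β) = g(β) = 0 and Δt · g'(x) ≤ ε for all x ∈ [−β, β]. Define f(x) = x − (Δt/ε) g(x). Then f maps [−β, β] into [−β, β]: for every x ∈ [−β, β], one has −β ≤ f(x) ≤ β. -/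
/-- Lemma 4.1 in the paper (after Lemma 2.1 of Shen–Tang–Yang): if `g = F'` vanishes at
`±β`, is differentiable on `[-β, β]`, and `Δt·g'(x) ≤ ε` there, then
`f(x) = x - (Δt/ε)·g(x)` maps `[-β, β]` into `[-β, β]`. -/
theorem imex_explicit_part_preserves_bounds
    (β Δt ε : ℝ) (hβ : 0 < β) (hΔt : 0 < Δt) (hε : 0 < ε)
    (g : ℝ → ℝ)
    (hdiff : DifferentiableOn ℝ g (Set.Icc (-β) β))
    (hgm : g (-β) = 0) (hgp : g β = 0)
    (hderiv : ∀ x ∈ Set.Icc (-β) β, Δt * derivWithin g (Set.Icc (-β) β) x ≤ ε)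
    (x : ℝ) (hx : x ∈ Set.Icc (-β) β) :
    x - Δt / ε * g x ∈ Set.Icc (-β) β := by
  have hslope := (convex_Icc (-β) β).image_sub_le_mul_sub_of_deriv_le
    hdiff.continuousOn (hdiff.mono interior_subset) (C := ε / Δt) fun y hy => by
      rw [← derivWithin_of_mem_nhds (mem_interior_iff_mem_nhds.mp hy), le_div_iff₀' hΔt]
      exact hderiv y (interior_subset hy)
  have hscale {a b : ℝ} (h : a ≤ ε / Δt * b) : Δt / ε * a ≤ b := by
    calc Δt / ε * a ≤ Δt / ε * (ε / Δt * b) := by gcongr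
      _ = b := by field_simp
  have hleft := hscale (hslope (-β) (Set.left_mem_Icc.mpr (by linarith)) x hx hx.1)
  have hright := hscale (hslope x hx β (Set.right_mem_Icc.mpr (by linarith)) hx.2)
  rw [hgm] at hleft
  rw [hgp] at hright
  constructor <;> linarith
end

section
/- Assume c > 0 and h·|u_i| ≤ 2μ for all 1 ≤ i ≤ n. Then the matrix B = A_d + A^z (explicitly: (Bφ)_0 = c·φ_0, (Bφ)_{n+1} = c·φ_{n+1}, (Bφ)_i = (c+2)·φ_i for odd 1 ≤ i ≤ n, and (Bφ)_i = (c + 7/2)·φ_i − 2(1 + h·u_i/(2μ))·φ_{i−1} − 2(1 − h·u_i/(2μ))·φ_{i+1} for even 1 ≤ i ≤ n) is invertible and every entry of B^{-1} is non-negative. -/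
open Matrix

/-- The matrix `B = A_d + A^z` of the splitting of the scaled 1D fourth-order scheme matrix:
row `0` and row `n+1` (boundary rows) are `c` on the diagonal; odd interior rows (cell
centers) are `c + 2` on the diagonal; even interior rows (cell ends) have diagonal
`c + 7/2` and entries `-2(1 ± h·uᵢ/(2μ))` at columns `i ∓ 1`, where `c = h²/(μ·Δt)`. -/
noncomputable def schemeB1D (n : ℕ) (h μ Δt : ℝ) (u : ℕ → ℝ) :
    Matrix (Fin (n + 2)) (Fin (n + 2)) ℝ :=
  Matrix.of fun i j =>
    if (i : ℕ) = 0 ∨ (i : ℕ) = n + 1 then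
      (if (j : ℕ) = (i : ℕ) then h ^ 2 / (μ * Δt) else 0)
    else if Odd (i : ℕ) then
      (if (j : ℕ) = (i : ℕ) then h ^ 2 / (μ * Δt) + 2 else 0)
    else if (j : ℕ) = (i : ℕ) - 1 then -2 * (1 + h * u (i : ℕ) / (2 * μ))
    else if (j : ℕ) = (i : ℕ) then h ^ 2 / (μ * Δt) + 7 / 2
    else if (j : ℕ) = (i : ℕ) + 1 then -2 * (1 - h * u (i : ℕ) / (2 * μ))
    else 0

/-- A matrix with positive diagonal and non-positive off-diagonal part whose off-diagonal
entries never chain (`M i k * M k j = 0` for `i ≠ k ≠ j`) is inverse-positive: writing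
`M = D + Z`, its inverse is `D⁻¹ - D⁻¹ Z D⁻¹`. -/
theorem isUnit_det_and_inv_nonneg_of_offDiag_mul_eq_zero {ι : Type*} [Fintype ι] [DecidableEq ι]
    (M : Matrix ι ι ℝ) (hdiag : ∀ i, 0 < M i i) (hoff : ∀ i j, i ≠ j → M i j ≤ 0)
    (hmul : ∀ i k j, i ≠ k → k ≠ j → M i k * M k j = 0) :
    IsUnit M.det ∧ ∀ i j, 0 ≤ M⁻¹ i j := by
  set D : Matrix ι ι ℝ := diagonal fun i => M i i with hD
  set E : Matrix ι ι ℝ := diagonal fun i => (M i i)⁻¹ with hE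
  set Z : Matrix ι ι ℝ := M - D with hZ
  have hZ_self (i : ι) : Z i i = 0 := by simp [hZ, hD]
  have hZ_ne {i j : ι} (hij : i ≠ j) : Z i j = M i j := by simp [hZ, hD, hij]
  have hDE : D * E = 1 := by
    rw [hD, hE, diagonal_mul_diagonal, ← diagonal_one]
    congr 1
    ext i
    exact mul_inv_cancel₀ (hdiag i).ne'
  have hZEZ : Z * E * Z = 0 := by
    ext i j
    rw [Matrix.mul_apply]
    refine Finset.sum_eq_zero fun k _ => ?_
    rw [hE, mul_diagonal]
    by_cases hik : i = k
    · simp [hik, hZ_self]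
    by_cases hkj : k = j
    · simp [hkj, hZ_self]
    rw [hZ_ne hik, hZ_ne hkj, mul_right_comm, hmul i k j hik hkj, zero_mul]
  have hinv : M * (E - E * Z * E) = 1 := by
    have hM : M = D + Z := by simp [hZ]
    calc M * (E - E * Z * E)
        = D * E - (D * E) * Z * E + Z * E - (Z * E * Z) * E := by
          rw [hM]; noncomm_ring
      _ = 1 := by rw [hDE, hZEZ]; noncomm_ring
  refine ⟨isUnit_det_of_right_inverse hinv, fun i j => ?_⟩
  rw [inv_eq_right_inv hinv, Matrix.sub_apply, hE, mul_diagonal, diagonal_mul]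
  have hi := inv_pos.2 (hdiag i)
  have hj := inv_pos.2 (hdiag j)
  by_cases hij : i = j
  · subst hij
    simpa [hZ_self] using hi.le
  · rw [diagonal_apply_ne _ hij, hZ_ne hij, zero_sub, neg_nonneg]
    exact mul_nonpos_of_nonpos_of_nonneg
      (mul_nonpos_of_nonneg_of_nonpos hi.le (hoff i j hij)) hj.le

/-- Section 3.4.2 of the paper: under `c > 0` and `h·|uᵢ| ≤ 2μ`, the matrix
`B = A_d + A^z` is a nonsingular M-matrix, hence inverse-positive. -/
theorem schemeB1D_inverse_positive
    (n : ℕ) (hodd : Odd n) (hn : 3 ≤ n)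
    (h μ Δt : ℝ) (hh : 0 < h) (hμ : 0 < μ) (hΔt : 0 < Δt)
    (u : ℕ → ℝ) (hu : ∀ i, 1 ≤ i → i ≤ n → h * |u i| ≤ 2 * μ) :
    IsUnit (schemeB1D n h μ Δt u).det ∧ ∀ i j, 0 ≤ (schemeB1D n h μ Δt u)⁻¹ i j := by
  have hc : 0 < h ^ 2 / (μ * Δt) := by positivity
  refine isUnit_det_and_inv_nonneg_of_offDiag_mul_eq_zero _ (fun i => ?_) (fun i j hij => ?_)
    (fun i k j hik hkj => ?_)
  · simp only [schemeB1D, Matrix.of_apply]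
    split_ifs <;> first | positivity | omega
  · have hij' : (j : ℕ) ≠ i := fun e => hij (Fin.ext e.symm)
    simp only [schemeB1D, Matrix.of_apply, if_neg hij']
    by_cases hb : (i : ℕ) = 0 ∨ (i : ℕ) = n + 1
    · rw [if_pos hb]
    have hui : |h * u i / (2 * μ)| ≤ 1 := by
      rw [abs_div, abs_mul, abs_of_pos hh, abs_of_pos (by positivity : 0 < 2 * μ),
        div_le_one (by positivity)]
      exact hu i (by omega) (by omega)
    obtain ⟨hl, hr⟩ := abs_le.1 hui
    split_ifs <;> linarith
  · have hik' : (k : ℕ) ≠ i := fun e => hik (Fin.ext e.symm)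
    have hkj' : (j : ℕ) ≠ k := fun e => hkj (Fin.ext e.symm)
    by_cases hk : Odd (k : ℕ)
    · simp [schemeB1D, hkj', hk]
    · refine mul_eq_zero_of_left ?_ _
      rw [Nat.odd_iff] at hk
      simp only [schemeB1D, Matrix.of_apply, if_neg hik', Nat.odd_iff]
      split_ifs <;> first | rfl | omega
end

section
/- Set a = (h/(2μ))·‖u‖_∞ and assume c > 0 and 8a² + (20 + 2c)a + c ≤ 6. Then the entrywise matrix inequality A_a^+ ≤ A^z A_d^{-1} A^s holds, i.e., every entry of A^z A_d^{-1} A^s − A_a^+ is non-negative. -/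
open Matrix

/-- The positive off-diagonal part `A_a⁺` of the scaled 1D fourth-order scheme matrix:
nonzero only in even interior rows `i` (cell ends), with entries `(1 + h·uᵢ/μ)/4` at
column `i - 2` and `(1 - h·uᵢ/μ)/4` at column `i + 2`. -/
noncomputable def Ap1D (n : ℕ) (h μ : ℝ) (u : ℕ → ℝ) :
    Matrix (Fin (n + 2)) (Fin (n + 2)) ℝ :=
  Matrix.of fun i j =>
    if 1 ≤ (i : ℕ) ∧ (i : ℕ) ≤ n ∧ Even (i : ℕ) then
      if (j : ℕ) = (i : ℕ) - 2 then (1 + h * u (i : ℕ) / μ) / 4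
      else if (j : ℕ) = (i : ℕ) + 2 then (1 - h * u (i : ℕ) / μ) / 4
      else 0
    else 0

/-- The part `A^z` of the splitting: nonzero only in even interior rows `i` (cell ends),
with entries `-2(1 + h·uᵢ/(2μ))` at column `i - 1` and `-2(1 - h·uᵢ/(2μ))` at `i + 1`. -/
noncomputable def Az1D (n : ℕ) (h μ : ℝ) (u : ℕ → ℝ) :
    Matrix (Fin (n + 2)) (Fin (n + 2)) ℝ :=
  Matrix.of fun i j =>
    if 1 ≤ (i : ℕ) ∧ (i : ℕ) ≤ n ∧ Even (i : ℕ) then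
      if (j : ℕ) = (i : ℕ) - 1 then -2 * (1 + h * u (i : ℕ) / (2 * μ))
      else if (j : ℕ) = (i : ℕ) + 1 then -2 * (1 - h * u (i : ℕ) / (2 * μ))
      else 0
    else 0

/-- The part `A^s` of the splitting: nonzero only in odd interior rows `i` (cell centers),
with entries `-(1 + h·uᵢ/(2μ))` at column `i - 1` and `-(1 - h·uᵢ/(2μ))` at `i + 1`. -/
noncomputable def As1D (n : ℕ) (h μ : ℝ) (u : ℕ → ℝ) :
    Matrix (Fin (n + 2)) (Fin (n + 2)) ℝ :=
  Matrix.of fun i j =>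
    if 1 ≤ (i : ℕ) ∧ (i : ℕ) ≤ n ∧ Odd (i : ℕ) then
      if (j : ℕ) = (i : ℕ) - 1 then -(1 + h * u (i : ℕ) / (2 * μ))
      else if (j : ℕ) = (i : ℕ) + 1 then -(1 - h * u (i : ℕ) / (2 * μ))
      else 0
    else 0

/-- The inverse `A_d⁻¹` of the diagonal part: diagonal with entries `1/c` at boundary rows,
`1/(c+2)` at odd interior rows (cell centers) and `1/(c+7/2)` at even interior rows (cell
ends), where `c = h²/(μ·Δt)`. -/
noncomputable def AdInv1D (n : ℕ) (h μ Δt : ℝ) :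
    Matrix (Fin (n + 2)) (Fin (n + 2)) ℝ :=
  Matrix.of fun i j =>
    if (j : ℕ) = (i : ℕ) then
      if (i : ℕ) = 0 ∨ (i : ℕ) = n + 1 then 1 / (h ^ 2 / (μ * Δt))
      else if Odd (i : ℕ) then 1 / (h ^ 2 / (μ * Δt) + 2)
      else 1 / (h ^ 2 / (μ * Δt) + 7 / 2)
    else 0

theorem Matrix.mul_mul_nonneg_term_le {ι : Type*} [Fintype ι] {P D S : Matrix ι ι ℝ}
    (hP : ∀ i j, P i j ≤ 0) (hD : ∀ i j, 0 ≤ D i j) (hS : ∀ i j, S i j ≤ 0) (i k l j : ι) :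
    0 ≤ P i k * D k l * S l j ∧ P i k * D k l * S l j ≤ (P * D * S) i j := by
  have hPD : ∀ k l, P i k * D k l ≤ 0 := fun k l =>
    mul_nonpos_of_nonpos_of_nonneg (hP i k) (hD k l)
  have hsum : ∀ l, (P * D) i l ≤ P i k * D k l := fun l => by
    rw [Matrix.mul_apply, ← neg_le_neg_iff, ← Finset.sum_neg_distrib]
    exact Finset.single_le_sum (f := fun k => -(P i k * D k l))
      (fun k _ => neg_nonneg.2 (hPD k l)) (Finset.mem_univ k)
  refine ⟨mul_nonneg_of_nonpos_of_nonpos (hPD k l) (hS l j), ?_⟩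
  rw [Matrix.mul_apply (M := P * D)]
  refine (mul_le_mul_of_nonpos_right (hsum l) (hS l j)).trans ?_
  exact Finset.single_le_sum (f := fun l => (P * D) i l * S l j)
    (fun l _ => mul_nonneg_of_nonpos_of_nonpos ((hsum l).trans (hPD k l)) (hS l j))
    (Finset.mem_univ l)

theorem AdInv1D_nonneg (n : ℕ) {h μ Δt : ℝ} (hc : 0 < h ^ 2 / (μ * Δt))
    (i j : Fin (n + 2)) : 0 ≤ AdInv1D n h μ Δt i j := by
  simp only [AdInv1D, Matrix.of_apply]
  split_ifs <;> positivity

theorem AdInv1D_apply_self_of_odd {n : ℕ} (h μ Δt : ℝ) (hn : Odd n) {i : Fin (n + 2)}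
    (hi : Odd (i : ℕ)) : AdInv1D n h μ Δt i i = 1 / (h ^ 2 / (μ * Δt) + 2) := by
  have hne : ¬((i : ℕ) = 0 ∨ (i : ℕ) = n + 1) := by
    obtain ⟨p, hp⟩ := hn
    obtain ⟨q, hq⟩ := hi
    omega
  simp only [AdInv1D, Matrix.of_apply]
  rw [if_pos trivial, if_neg hne, if_pos hi]

theorem Az1D_nonpos (n : ℕ) {h μ : ℝ} {u : ℕ → ℝ}
    (hu : ∀ i, 1 ≤ i → i ≤ n → |h * u i / (2 * μ)| ≤ 1) (i j : Fin (n + 2)) :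
    Az1D n h μ u i j ≤ 0 := by
  simp only [Az1D, Matrix.of_apply]
  split_ifs with hi <;> first
    | exact le_rfl
    | (have := abs_le.1 (hu i hi.1 hi.2.1)
       linarith [this.1, this.2])

theorem As1D_nonpos (n : ℕ) {h μ : ℝ} {u : ℕ → ℝ}
    (hu : ∀ i, 1 ≤ i → i ≤ n → |h * u i / (2 * μ)| ≤ 1) (i j : Fin (n + 2)) :
    As1D n h μ u i j ≤ 0 := by
  simp only [As1D, Matrix.of_apply]
  split_ifs with hi <;> first
    | exact le_rfl
    | (have := abs_le.1 (hu i hi.1 hi.2.1)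
       linarith [this.1, this.2])

theorem quarter_le_of_abs_le {a c x y : ℝ} (hc : 0 < c)
    (hcond : 8 * a ^ 2 + (20 + 2 * c) * a + c ≤ 6) (hx : |x| ≤ a) (hy : |y| ≤ a) :
    (1 + 2 * x) / 4 ≤ -2 * (1 + x) * (1 / (c + 2)) * -(1 + y) := by
  have ha : 0 ≤ a := (abs_nonneg x).trans hx
  have hac : 0 ≤ c * a := by positivity
  have ha1 : a ≤ 1 := by nlinarith [sq_nonneg a]
  obtain ⟨hx1, hx2⟩ := abs_le.1 hx
  obtain ⟨hy1, -⟩ := abs_le.1 hy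
  have hxy : (1 + x) * (1 - a) ≤ (1 + x) * (1 + y) :=
    mul_le_mul_of_nonneg_left (by linarith) (by linarith)
  have hlin : (c + 2) * (1 + 2 * x) ≤ 8 * ((1 + x) * (1 - a)) := by
    rcases le_total 0 (8 * (1 - a) - 2 * (c + 2)) with hs | hs
    · nlinarith [mul_nonneg hs (by linarith : 0 ≤ x + a)]
    · nlinarith [mul_nonneg (neg_nonneg.2 hs) (by linarith : 0 ≤ a - x)]
  have heq : -2 * (1 + x) * (1 / (c + 2)) * -(1 + y) = 2 * ((1 + x) * (1 + y)) / (c + 2) := by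
    ring
  rw [heq, div_le_div_iff₀ (by norm_num) (by linarith)]
  linarith

/-- Section 3.4.3 of the paper: with `a = (h/(2μ))·‖u‖_∞` and `c = h²/(μΔt) > 0`, if
`8a² + (20 + 2c)a + c ≤ 6` then the entrywise inequality `A_a⁺ ≤ A^z A_d⁻¹ A^s` holds. -/
theorem Ap1D_le_Az1D_AdInv1D_As1D
    (n : ℕ) (hodd : Odd n) (hn : 3 ≤ n)
    (h μ Δt : ℝ) (hh : 0 < h) (hμ : 0 < μ) (hΔt : 0 < Δt)
    (u : ℕ → ℝ) (m a : ℝ)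
    (hm : IsGreatest {x : ℝ | ∃ i : ℕ, 1 ≤ i ∧ i ≤ n ∧ x = |u i|} m)
    (ha : a = h / (2 * μ) * m)
    (hcond : 8 * a ^ 2 + (20 + 2 * (h ^ 2 / (μ * Δt))) * a + h ^ 2 / (μ * Δt) ≤ 6) :
    ∀ i j, Ap1D n h μ u i j ≤ (Az1D n h μ u * AdInv1D n h μ Δt * As1D n h μ u) i j := by
  have hc : 0 < h ^ 2 / (μ * Δt) := by positivity
  have hbound : ∀ i, 1 ≤ i → i ≤ n → |h * u i / (2 * μ)| ≤ a := fun i h1 h2 => by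
    have hui : |u i| ≤ m := hm.2 ⟨i, h1, h2, rfl⟩
    rw [ha, mul_div_right_comm, abs_mul, abs_of_pos (by positivity : 0 < h / (2 * μ))]
    gcongr
  have ha0 : 0 ≤ a := (abs_nonneg _).trans (hbound 1 le_rfl (by omega))
  have ha1 : a ≤ 1 := by nlinarith [sq_nonneg a, mul_nonneg hc.le ha0]
  have hone : ∀ i, 1 ≤ i → i ≤ n → |h * u i / (2 * μ)| ≤ 1 := fun i h1 h2 =>
    (hbound i h1 h2).trans ha1
  intro i j
  have hterm := fun k => Matrix.mul_mul_nonneg_term_le (Az1D_nonpos n hone)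
    (AdInv1D_nonneg n hc) (As1D_nonpos n hone) i k k j
  have hdouble : h * u i / μ = 2 * (h * u i / (2 * μ)) := by field_simp
  by_cases hi : 1 ≤ (i : ℕ) ∧ (i : ℕ) ≤ n ∧ Even (i : ℕ)
  · obtain ⟨hi1, hin, hie⟩ := id hi
    obtain ⟨p, hp⟩ := id hie
    obtain ⟨q, hq⟩ := id hodd
    by_cases hj : (j : ℕ) = i - 2
    · refine le_trans ?_ (hterm ⟨i - 1, by omega⟩).2
      have hk : Odd ((i : ℕ) - 1) := ⟨p - 1, by omega⟩
      have h1 : Ap1D n h μ u i j = (1 + h * u i / μ) / 4 := by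
        simp [Ap1D, hi, hj]
      have h2 : Az1D n h μ u i ⟨i - 1, by omega⟩ = -2 * (1 + h * u i / (2 * μ)) := by
        simp [Az1D, hi]
      have h3 : AdInv1D n h μ Δt ⟨i - 1, by omega⟩ ⟨i - 1, by omega⟩ =
          1 / (h ^ 2 / (μ * Δt) + 2) :=
        AdInv1D_apply_self_of_odd h μ Δt hodd hk
      have h4 : As1D n h μ u ⟨i - 1, by omega⟩ j =
          -(1 + h * u ((i : ℕ) - 1) / (2 * μ)) := by
        simp only [As1D, Matrix.of_apply]
        rw [if_pos ⟨by omega, by omega, hk⟩, if_pos (by omega)]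
      rw [h1, h2, h3, h4, hdouble]
      exact quarter_le_of_abs_le hc hcond (hbound _ hi1 hin)
        (hbound _ (by omega) (by omega))
    by_cases hj' : (j : ℕ) = i + 2
    · refine le_trans ?_ (hterm ⟨i + 1, by omega⟩).2
      have hk : Odd ((i : ℕ) + 1) := ⟨p, by omega⟩
      have h1 : Ap1D n h μ u i j = (1 - h * u i / μ) / 4 := by
        simp only [Ap1D, Matrix.of_apply]
        rw [if_pos hi, if_neg hj, if_pos hj']
      have h2 : Az1D n h μ u i ⟨i + 1, by omega⟩ = -2 * (1 - h * u i / (2 * μ)) := by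
        simp only [Az1D, Matrix.of_apply]
        rw [if_pos hi, if_neg (by omega), if_pos trivial]
      have h3 : AdInv1D n h μ Δt ⟨i + 1, by omega⟩ ⟨i + 1, by omega⟩ =
          1 / (h ^ 2 / (μ * Δt) + 2) :=
        AdInv1D_apply_self_of_odd h μ Δt hodd hk
      have h4 : As1D n h μ u ⟨i + 1, by omega⟩ j =
          -(1 - h * u ((i : ℕ) + 1) / (2 * μ)) := by
        simp only [As1D, Matrix.of_apply]
        rw [if_pos ⟨by omega, by omega, hk⟩, if_neg (by omega), if_pos (by omega)]
      have key := quarter_le_of_abs_le hc hcond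
        ((abs_neg _).trans_le (hbound _ hi1 hin))
        ((abs_neg _).trans_le (hbound (i + 1) (by omega) (by omega)))
      rw [mul_neg, ← sub_eq_add_neg, ← sub_eq_add_neg, ← sub_eq_add_neg] at key
      rwa [h1, h2, h3, h4, hdouble]
    · have h0 : Ap1D n h μ u i j = 0 := by simp [Ap1D, hj, hj']
      exact h0.trans_le ((hterm i).1.trans (hterm i).2)
  · have h0 : Ap1D n h μ u i j = 0 := by
      simp only [Ap1D, Matrix.of_apply]
      exact if_neg hi
    exact h0.trans_le ((hterm i).1.trans (hterm i).2)
end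

section
/- Assume c > 0 and h·|u_{i,j}| ≤ 2μ and h·|v_{i,j}| ≤ 2μ for all interior indices (i,j). Then the operator B = A_d + A^z (explicitly: (Bφ)_{i,j} = c·φ_{i,j} at boundary indices; (Bφ)_{i,j} = (c+4)·φ_{i,j} at cell centers; (Bφ)_{i,j} = (c + 11/2)·φ_{i,j} − 2(1 + h·v_{i,j}/(2μ))φ_{i,j−1} − 2(1 − h·v_{i,j}/(2μ))φ_{i,j+1} at x-edge centers; (Bφ)_{i,j} = (c + 11/2)·φ_{i,j} − 2(1 + h·u_{i,j}/(2μ))φ_{i−1,j} − 2(1 − h·u_{i,j}/(2μ))φ_{i+1,j} at y-edge centers; (Bφ)_{i,j} = (c + 7)·φ_{i,j} − 2(1 + h·u_{i,j}/(2μ))φ_{i−1,j} − 2(1 − h·u_{i,j}/(2μ))φ_{i+1,j} − 2(1 + h·v_{i,j}/(2μ))φ_{i,j−1} − 2(1 − h·v_{i,j}/(2μ))φ_{i,j+1} at knots) is bijective and its inverse maps entrywise-nonnegative arrays to entrywise-nonnegative arrays. -/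
/-- The value of a grid array at a pair of natural indices (`0` outside the grid;
inside the grid all index arithmetic of the scheme stays in range). -/
noncomputable def gridVal (nx ny : ℕ) (φ : Fin (nx + 2) → Fin (ny + 2) → ℝ)
    (i j : ℕ) : ℝ :=
  if hi : i < nx + 2 then if hj : j < ny + 2 then φ ⟨i, hi⟩ ⟨j, hj⟩ else 0 else 0

/-- `(i,j)` is a boundary index of the `(nx+2) × (ny+2)` grid. -/
def isBdry (nx ny i j : ℕ) : Prop := i = 0 ∨ i = nx + 1 ∨ j = 0 ∨ j = ny + 1

instance (nx ny i j : ℕ) : Decidable (isBdry nx ny i j) := by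
  unfold isBdry; infer_instance

/-- The operator `B = A_d + A^z` of the splitting of the scaled 2D fourth-order scheme
operator, with `c = h²/(μΔt)`: `(Bφ)ᵢⱼ = c·φᵢⱼ` at boundary indices, `(c+4)·φᵢⱼ` at cell
centers, `(c + 11/2)·φᵢⱼ - 2(1 + h·vᵢⱼ/(2μ))φᵢ,ⱼ₋₁ - 2(1 - h·vᵢⱼ/(2μ))φᵢ,ⱼ₊₁` at x-edge
centers, the analogous expression with `u` and `i ∓ 1` at y-edge centers, and
`(c+7)·φᵢⱼ` minus all four neighbor terms at interior knots. -/
noncomputable def schemeB2D (nx ny : ℕ) (h μ Δt : ℝ) (u v : ℕ → ℕ → ℝ)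
    (φ : Fin (nx + 2) → Fin (ny + 2) → ℝ) (I : Fin (nx + 2)) (J : Fin (ny + 2)) : ℝ :=
  let c := h ^ 2 / (μ * Δt)
  let i := (I : ℕ)
  let j := (J : ℕ)
  let ψ := gridVal nx ny φ
  if isBdry nx ny i j then c * φ I J
  else if Odd i ∧ Odd j then (c + 4) * ψ i j
  else if Odd i then
    (c + 11 / 2) * ψ i j - 2 * (1 + h * v i j / (2 * μ)) * ψ i (j - 1)
      - 2 * (1 - h * v i j / (2 * μ)) * ψ i (j + 1)
  else if Odd j then
    (c + 11 / 2) * ψ i j - 2 * (1 + h * u i j / (2 * μ)) * ψ (i - 1) j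
      - 2 * (1 - h * u i j / (2 * μ)) * ψ (i + 1) j
  else
    (c + 7) * ψ i j - 2 * (1 + h * u i j / (2 * μ)) * ψ (i - 1) j
      - 2 * (1 - h * u i j / (2 * μ)) * ψ (i + 1) j
      - 2 * (1 + h * v i j / (2 * μ)) * ψ i (j - 1)
      - 2 * (1 - h * v i j / (2 * μ)) * ψ i (j + 1)

theorem gridVal_add (nx ny : ℕ) (φ χ : Fin (nx + 2) → Fin (ny + 2) → ℝ) (i j : ℕ) :
    gridVal nx ny (φ + χ) i j = gridVal nx ny φ i j + gridVal nx ny χ i j := by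
  unfold gridVal
  split_ifs <;> simp

theorem gridVal_smul (nx ny : ℕ) (a : ℝ) (φ : Fin (nx + 2) → Fin (ny + 2) → ℝ) (i j : ℕ) :
    gridVal nx ny (a • φ) i j = a * gridVal nx ny φ i j := by
  unfold gridVal
  split_ifs <;> simp

theorem gridVal_coe (nx ny : ℕ) (φ : Fin (nx + 2) → Fin (ny + 2) → ℝ)
    (I : Fin (nx + 2)) (J : Fin (ny + 2)) : gridVal nx ny φ I J = φ I J := by
  simp [gridVal]

/-- `schemeB2D` as a linear map. -/
noncomputable def schemeB2DLinearMap (nx ny : ℕ) (h μ Δt : ℝ) (u v : ℕ → ℕ → ℝ) :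
    (Fin (nx + 2) → Fin (ny + 2) → ℝ) →ₗ[ℝ] (Fin (nx + 2) → Fin (ny + 2) → ℝ) where
  toFun := schemeB2D nx ny h μ Δt u v
  map_add' φ χ := by
    funext I J
    simp only [schemeB2D, gridVal_add, Pi.add_apply]
    split_ifs <;> ring
  map_smul' a φ := by
    funext I J
    simp only [schemeB2D, gridVal_smul, Pi.smul_apply, smul_eq_mul, RingHom.id_apply]
    split_ifs <;> ring

theorem one_add_sub_div_nonneg_of_mul_abs_le {h μ w : ℝ} (hh : 0 < h) (hμ : 0 < μ)
    (hw : h * |w| ≤ 2 * μ) : 0 ≤ 1 + h * w / (2 * μ) ∧ 0 ≤ 1 - h * w / (2 * μ) := by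
  have hd : |h * w / (2 * μ)| ≤ 1 := by
    rw [abs_div, abs_mul, abs_of_pos hh, abs_of_pos (by positivity : 0 < 2 * μ)]
    exact (div_le_one (by positivity)).2 hw
  obtain ⟨h1, h2⟩ := abs_le.1 hd
  constructor <;> linarith

/-- `schemeB2D` is monotone: an array with nonnegative image is nonnegative. The operator is
triangular for the order cell centers, edge centers, knots. -/
theorem nonneg_of_schemeB2D_nonneg
    (nx ny : ℕ) (hnx : Odd nx) (hny : Odd ny)
    (h μ Δt : ℝ) (hh : 0 < h) (hμ : 0 < μ) (hΔt : 0 < Δt)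
    (u v : ℕ → ℕ → ℝ)
    (huv : ∀ i j : ℕ, 1 ≤ i → i ≤ nx → 1 ≤ j → j ≤ ny →
      h * |u i j| ≤ 2 * μ ∧ h * |v i j| ≤ 2 * μ)
    (φ : Fin (nx + 2) → Fin (ny + 2) → ℝ)
    (hφ : ∀ I J, 0 ≤ schemeB2D nx ny h μ Δt u v φ I J) (I : Fin (nx + 2)) (J : Fin (ny + 2)) :
    0 ≤ φ I J := by
  have hc : 0 < h ^ 2 / (μ * Δt) := by positivity
  simp only [schemeB2D] at hφ
  set c := h ^ 2 / (μ * Δt)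
  set ψ := gridVal nx ny φ with hψ
  have hu : ∀ i j : ℕ, 1 ≤ i → i ≤ nx → 1 ≤ j → j ≤ ny →
      0 ≤ 1 + h * u i j / (2 * μ) ∧ 0 ≤ 1 - h * u i j / (2 * μ) := fun i j h1 h2 h3 h4 ↦
    one_add_sub_div_nonneg_of_mul_abs_le hh hμ (huv i j h1 h2 h3 h4).1
  have hv : ∀ i j : ℕ, 1 ≤ i → i ≤ nx → 1 ≤ j → j ≤ ny →
      0 ≤ 1 + h * v i j / (2 * μ) ∧ 0 ≤ 1 - h * v i j / (2 * μ) := fun i j h1 h2 h3 h4 ↦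
    one_add_sub_div_nonneg_of_mul_abs_le hh hμ (huv i j h1 h2 h3 h4).2
  have interior : ∀ i j : ℕ, 1 ≤ i → i ≤ nx → 1 ≤ j → j ≤ ny → ¬ isBdry nx ny i j := by
    intro i j _ _ _ _
    unfold isBdry
    omega
  have even_interior : ∀ n i : ℕ, Odd n → ¬ Odd i → 1 ≤ i → i ≤ n →
      Odd (i - 1) ∧ Odd (i + 1) ∧ 1 ≤ i - 1 ∧ i - 1 ≤ n ∧ 1 ≤ i + 1 ∧ i + 1 ≤ n := by
    intro n i hn hi _ _
    simp only [Nat.odd_iff] at *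
    omega
  have center : ∀ i j : ℕ, 1 ≤ i → i ≤ nx → 1 ≤ j → j ≤ ny → Odd i → Odd j → 0 ≤ ψ i j := by
    intro i j h1 h2 h3 h4 hi hj
    have key := hφ ⟨i, by omega⟩ ⟨j, by omega⟩
    simp only [if_neg (interior i j h1 h2 h3 h4), if_pos (And.intro hi hj)] at key
    exact nonneg_of_mul_nonneg_right key (by positivity)
  have xEdge : ∀ i j : ℕ, 1 ≤ i → i ≤ nx → 1 ≤ j → j ≤ ny → Odd i → ¬ Odd j → 0 ≤ ψ i j := by
    intro i j h1 h2 h3 h4 hi hj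
    have key := hφ ⟨i, by omega⟩ ⟨j, by omega⟩
    simp only [if_neg (interior i j h1 h2 h3 h4), hi, hj, and_false, if_true, if_false] at key
    obtain ⟨o1, o2, a1, a2, b1, b2⟩ := even_interior ny j hny hj h3 h4
    obtain ⟨v1, v2⟩ := hv i j h1 h2 h3 h4
    have m1 := mul_nonneg v1 (center i (j - 1) h1 h2 a1 a2 hi o1)
    have m2 := mul_nonneg v2 (center i (j + 1) h1 h2 b1 b2 hi o2)
    exact nonneg_of_mul_nonneg_right (a := c + 11 / 2) (by linarith) (by positivity)
  have yEdge : ∀ i j : ℕ, 1 ≤ i → i ≤ nx → 1 ≤ j → j ≤ ny → ¬ Odd i → Odd j → 0 ≤ ψ i j := by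
    intro i j h1 h2 h3 h4 hi hj
    have key := hφ ⟨i, by omega⟩ ⟨j, by omega⟩
    simp only [if_neg (interior i j h1 h2 h3 h4), hi, hj, false_and, if_true, if_false] at key
    obtain ⟨o1, o2, a1, a2, b1, b2⟩ := even_interior nx i hnx hi h1 h2
    obtain ⟨u1, u2⟩ := hu i j h1 h2 h3 h4
    have m1 := mul_nonneg u1 (center (i - 1) j a1 a2 h3 h4 o1 hj)
    have m2 := mul_nonneg u2 (center (i + 1) j b1 b2 h3 h4 o2 hj)
    exact nonneg_of_mul_nonneg_right (a := c + 11 / 2) (by linarith) (by positivity)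
  have knot : ∀ i j : ℕ, 1 ≤ i → i ≤ nx → 1 ≤ j → j ≤ ny → ¬ Odd i → ¬ Odd j → 0 ≤ ψ i j := by
    intro i j h1 h2 h3 h4 hi hj
    have key := hφ ⟨i, by omega⟩ ⟨j, by omega⟩
    simp only [if_neg (interior i j h1 h2 h3 h4), hi, hj, false_and, if_false] at key
    obtain ⟨o1, o2, a1, a2, b1, b2⟩ := even_interior nx i hnx hi h1 h2
    obtain ⟨p1, p2, d1, d2, e1, e2⟩ := even_interior ny j hny hj h3 h4
    obtain ⟨u1, u2⟩ := hu i j h1 h2 h3 h4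
    obtain ⟨v1, v2⟩ := hv i j h1 h2 h3 h4
    have m1 := mul_nonneg u1 (xEdge (i - 1) j a1 a2 h3 h4 o1 hj)
    have m2 := mul_nonneg u2 (xEdge (i + 1) j b1 b2 h3 h4 o2 hj)
    have m3 := mul_nonneg v1 (yEdge i (j - 1) h1 h2 d1 d2 hi p1)
    have m4 := mul_nonneg v2 (yEdge i (j + 1) h1 h2 e1 e2 hi p2)
    exact nonneg_of_mul_nonneg_right (a := c + 7) (by linarith) (by positivity)
  by_cases hb : isBdry nx ny I J
  · have key := hφ I J
    rw [if_pos hb] at key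
    exact nonneg_of_mul_nonneg_right key hc
  · rw [← gridVal_coe nx ny φ I J, ← hψ]
    have hI := I.isLt
    have hJ := J.isLt
    unfold isBdry at hb
    have h1 : 1 ≤ (I : ℕ) := by omega
    have h2 : (I : ℕ) ≤ nx := by omega
    have h3 : 1 ≤ (J : ℕ) := by omega
    have h4 : (J : ℕ) ≤ ny := by omega
    by_cases hi : Odd (I : ℕ) <;> by_cases hj : Odd (J : ℕ)
    · exact center I J h1 h2 h3 h4 hi hj
    · exact xEdge I J h1 h2 h3 h4 hi hj
    · exact yEdge I J h1 h2 h3 h4 hi hj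
    · exact knot I J h1 h2 h3 h4 hi hj

/-- Section 3.5.2 of the paper: if `c = h²/(μΔt) > 0` and `h·|uᵢⱼ| ≤ 2μ`, `h·|vᵢⱼ| ≤ 2μ`
at all interior indices, then `B = A_d + A^z` is bijective and its inverse maps
entrywise-nonnegative arrays to entrywise-nonnegative arrays. -/
theorem schemeB2D_inverse_positive
    (nx ny : ℕ) (hnx : Odd nx) (hny : Odd ny) (hnx3 : 3 ≤ nx) (hny3 : 3 ≤ ny)
    (h μ Δt : ℝ) (hh : 0 < h) (hμ : 0 < μ) (hΔt : 0 < Δt)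
    (u v : ℕ → ℕ → ℝ)
    (huv : ∀ i j : ℕ, 1 ≤ i → i ≤ nx → 1 ≤ j → j ≤ ny →
      h * |u i j| ≤ 2 * μ ∧ h * |v i j| ≤ 2 * μ) :
    Function.Bijective (schemeB2D nx ny h μ Δt u v) ∧
      ∀ φ : Fin (nx + 2) → Fin (ny + 2) → ℝ,
        (∀ I J, 0 ≤ schemeB2D nx ny h μ Δt u v φ I J) → ∀ I J, 0 ≤ φ I J := by
  have hpos := nonneg_of_schemeB2D_nonneg nx ny hnx hny h μ Δt hh hμ hΔt u v huv
  refine ⟨?_, hpos⟩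
  let L := schemeB2DLinearMap nx ny h μ Δt u v
  have hinj : Function.Injective L := by
    rw [injective_iff_map_eq_zero]
    intro φ hφ
    have hneg : L (-φ) = 0 := by rw [map_neg, hφ, neg_zero]
    funext I J
    refine le_antisymm ?_ (hpos φ (fun I J ↦ (congr_fun₂ hφ I J).ge) I J)
    exact neg_nonneg.1 (hpos (-φ) (fun I J ↦ (congr_fun₂ hneg I J).ge) I J)
  exact ⟨hinj, LinearMap.injective_iff_surjective.1 hinj⟩
end

section
/- Set a = (h/(2μ))·max over interior indices of max(|u_{i,j}|, |v_{i,j}|), and assume c > 0 and 8a² + (11 + 2c)a + c ≤ 5/2. Then the entrywise inequality A_a^+ ≤ A^z A_d^{-1} A^s holds: with respect to the standard basis of arrays indexed by grid indices, every matrix entry of the composition A^z ∘ A_d^{-1} ∘ A^s is greater than or equal to the corresponding matrix entry of A_a^+. -/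
/-- The positive off-diagonal part `A_a⁺` of the scaled 2D fourth-order scheme operator:
zero at boundary indices and cell centers; at x-edge centers it carries the coefficients
`(1 ± h·vᵢⱼ/μ)/4` of `φᵢ,ⱼ∓₂`; at y-edge centers the coefficients `(1 ± h·uᵢⱼ/μ)/4` of
`φᵢ∓₂,ⱼ`; at interior knots both. -/
noncomputable def Ap2D (nx ny : ℕ) (h μ : ℝ) (u v : ℕ → ℕ → ℝ)
    (φ : Fin (nx + 2) → Fin (ny + 2) → ℝ) (I : Fin (nx + 2)) (J : Fin (ny + 2)) : ℝ :=
  let i := (I : ℕ)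
  let j := (J : ℕ)
  let ψ := gridVal nx ny φ
  if isBdry nx ny i j then 0
  else if Odd i ∧ Odd j then 0
  else if Odd i then
    (1 + h * v i j / μ) / 4 * ψ i (j - 2) + (1 - h * v i j / μ) / 4 * ψ i (j + 2)
  else if Odd j then
    (1 + h * u i j / μ) / 4 * ψ (i - 2) j + (1 - h * u i j / μ) / 4 * ψ (i + 2) j
  else
    (1 + h * u i j / μ) / 4 * ψ (i - 2) j + (1 - h * u i j / μ) / 4 * ψ (i + 2) j
      + (1 + h * v i j / μ) / 4 * ψ i (j - 2) + (1 - h * v i j / μ) / 4 * ψ i (j + 2)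

/-- The part `A^z` of the splitting of the scaled 2D fourth-order scheme operator:
zero at boundary indices and cell centers; at x-edge centers
`-2(1 + h·vᵢⱼ/(2μ))φᵢ,ⱼ₋₁ - 2(1 - h·vᵢⱼ/(2μ))φᵢ,ⱼ₊₁`; at y-edge centers the analogous
`u`-expression; at interior knots the sum of both. -/
noncomputable def Az2D (nx ny : ℕ) (h μ : ℝ) (u v : ℕ → ℕ → ℝ)
    (φ : Fin (nx + 2) → Fin (ny + 2) → ℝ) (I : Fin (nx + 2)) (J : Fin (ny + 2)) : ℝ :=
  let i := (I : ℕ)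
  let j := (J : ℕ)
  let ψ := gridVal nx ny φ
  if isBdry nx ny i j then 0
  else if Odd i ∧ Odd j then 0
  else if Odd i then
    -2 * (1 + h * v i j / (2 * μ)) * ψ i (j - 1) - 2 * (1 - h * v i j / (2 * μ)) * ψ i (j + 1)
  else if Odd j then
    -2 * (1 + h * u i j / (2 * μ)) * ψ (i - 1) j - 2 * (1 - h * u i j / (2 * μ)) * ψ (i + 1) j
  else
    -2 * (1 + h * u i j / (2 * μ)) * ψ (i - 1) j - 2 * (1 - h * u i j / (2 * μ)) * ψ (i + 1) j
      - 2 * (1 + h * v i j / (2 * μ)) * ψ i (j - 1) - 2 * (1 - h * v i j / (2 * μ)) * ψ i (j + 1)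

/-- The part `A^s` of the splitting of the scaled 2D fourth-order scheme operator:
zero at boundary indices and interior knots; at cell centers
`-(1 ± h·uᵢⱼ/(2μ))φᵢ∓₁,ⱼ - (1 ± h·vᵢⱼ/(2μ))φᵢ,ⱼ∓₁` (all four neighbors); at x-edge centers
only the `u`-terms; at y-edge centers only the `v`-terms. -/
noncomputable def As2D (nx ny : ℕ) (h μ : ℝ) (u v : ℕ → ℕ → ℝ)
    (φ : Fin (nx + 2) → Fin (ny + 2) → ℝ) (I : Fin (nx + 2)) (J : Fin (ny + 2)) : ℝ :=
  let i := (I : ℕ)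
  let j := (J : ℕ)
  let ψ := gridVal nx ny φ
  if isBdry nx ny i j then 0
  else if Odd i ∧ Odd j then
    -(1 + h * u i j / (2 * μ)) * ψ (i - 1) j - (1 - h * u i j / (2 * μ)) * ψ (i + 1) j
      - (1 + h * v i j / (2 * μ)) * ψ i (j - 1) - (1 - h * v i j / (2 * μ)) * ψ i (j + 1)
  else if Odd i then
    -(1 + h * u i j / (2 * μ)) * ψ (i - 1) j - (1 - h * u i j / (2 * μ)) * ψ (i + 1) j
  else if Odd j then
    -(1 + h * v i j / (2 * μ)) * ψ i (j - 1) - (1 - h * v i j / (2 * μ)) * ψ i (j + 1)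
  else 0

/-- The inverse `A_d⁻¹` of the diagonal part of the scaled 2D fourth-order scheme
operator, with `c = h²/(μΔt)`: multiplication by `1/c` at boundary indices, `1/(c+4)` at
cell centers, `1/(c + 11/2)` at edge centers and `1/(c+7)` at interior knots. -/
noncomputable def AdInv2D (nx ny : ℕ) (h μ Δt : ℝ)
    (φ : Fin (nx + 2) → Fin (ny + 2) → ℝ) (I : Fin (nx + 2)) (J : Fin (ny + 2)) : ℝ :=
  let c := h ^ 2 / (μ * Δt)
  let i := (I : ℕ)
  let j := (J : ℕ)
  if isBdry nx ny i j then φ I J / c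
  else if Odd i ∧ Odd j then φ I J / (c + 4)
  else if Odd i ∨ Odd j then φ I J / (c + 11 / 2)
  else φ I J / (c + 7)

/-- The standard basis array supported at the grid index `(K, L)`. -/
noncomputable def gridBasis (nx ny : ℕ) (K : Fin (nx + 2)) (L : Fin (ny + 2)) :
    Fin (nx + 2) → Fin (ny + 2) → ℝ :=
  fun I J => if I = K ∧ J = L then 1 else 0

theorem gridVal_nonneg {nx ny : ℕ} {φ : Fin (nx + 2) → Fin (ny + 2) → ℝ}
    (hφ : ∀ I J, 0 ≤ φ I J) (i j : ℕ) : 0 ≤ gridVal nx ny φ i j := by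
  unfold gridVal
  split_ifs <;> first | exact hφ _ _ | exact le_rfl

theorem gridBasis_nonneg (nx ny : ℕ) (K : Fin (nx + 2)) (L : Fin (ny + 2))
    (I : Fin (nx + 2)) (J : Fin (ny + 2)) : 0 ≤ gridBasis nx ny K L I J := by
  unfold gridBasis
  split_ifs <;> norm_num

/-- A nonpositive quantity divided by a small diagonal entry is bounded by each of its
nonpositive summands divided by a larger diagonal entry. -/
theorem div_le_neg_div_of_le_neg {s x d D : ℝ} (hd : 0 < d) (hdD : d ≤ D) (hx : 0 ≤ x)
    (hs : s ≤ -x) : s / d ≤ -(x / D) := by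
  have h₁ : s / d ≤ -x / d := div_le_div_of_nonneg_right hs hd.le
  have h₂ : x / D ≤ x / d := div_le_div_of_nonneg_left hx hd hdD
  rw [neg_div] at h₁
  linarith

/-- At interior indices with odd first coordinate, `A_d⁻¹ A^s φ` is bounded above by each of its
horizontal contributions. -/
theorem gridVal_AdInv2D_As2D_le_of_odd_left {nx ny : ℕ} {h μ Δt : ℝ} {u v : ℕ → ℕ → ℝ}
    (hc : 0 < h ^ 2 / (μ * Δt)) {φ : Fin (nx + 2) → Fin (ny + 2) → ℝ}
    (hφ : ∀ I J, 0 ≤ φ I J) {i j : ℕ} (hi : Odd i) (hinx : i ≤ nx) (hj : 1 ≤ j) (hjny : j ≤ ny)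
    (hu : |h * u i j / (2 * μ)| ≤ 1) (hv : |h * v i j / (2 * μ)| ≤ 1) :
    gridVal nx ny (AdInv2D nx ny h μ Δt (As2D nx ny h μ u v φ)) i j ≤
        -((1 + h * u i j / (2 * μ)) * gridVal nx ny φ (i - 1) j /
          (h ^ 2 / (μ * Δt) + 11 / 2)) ∧
      gridVal nx ny (AdInv2D nx ny h μ Δt (As2D nx ny h μ u v φ)) i j ≤
        -((1 - h * u i j / (2 * μ)) * gridVal nx ny φ (i + 1) j /
          (h ^ 2 / (μ * Δt) + 11 / 2)) := by
  obtain ⟨hu₁, hu₂⟩ := abs_le.1 hu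
  obtain ⟨hv₁, hv₂⟩ := abs_le.1 hv
  have hb : ¬ isBdry nx ny i j := by
    have := hi.pos
    unfold isBdry
    omega
  have n₁ : 0 ≤ (1 + h * u i j / (2 * μ)) * gridVal nx ny φ (i - 1) j :=
    mul_nonneg (by linarith) (gridVal_nonneg hφ _ _)
  have n₂ : 0 ≤ (1 - h * u i j / (2 * μ)) * gridVal nx ny φ (i + 1) j :=
    mul_nonneg (by linarith) (gridVal_nonneg hφ _ _)
  have n₃ : 0 ≤ (1 + h * v i j / (2 * μ)) * gridVal nx ny φ i (j - 1) :=
    mul_nonneg (by linarith) (gridVal_nonneg hφ _ _)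
  have n₄ : 0 ≤ (1 - h * v i j / (2 * μ)) * gridVal nx ny φ i (j + 1) :=
    mul_nonneg (by linarith) (gridVal_nonneg hφ _ _)
  rw [gridVal, dif_pos (by omega), dif_pos (by omega)]
  by_cases hjo : Odd j
  · simp only [AdInv2D, As2D, if_neg hb, hi, hjo, and_self, if_true]
    constructor <;> refine div_le_neg_div_of_le_neg ?_ ?_ ?_ ?_ <;> linarith
  · simp only [AdInv2D, As2D, if_neg hb, hi, hjo, and_false, if_false, true_or, if_true]
    constructor <;> refine div_le_neg_div_of_le_neg ?_ ?_ ?_ ?_ <;> linarith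

/-- At interior indices with odd second coordinate, `A_d⁻¹ A^s φ` is bounded above by each of its
vertical contributions. -/
theorem gridVal_AdInv2D_As2D_le_of_odd_right {nx ny : ℕ} {h μ Δt : ℝ} {u v : ℕ → ℕ → ℝ}
    (hc : 0 < h ^ 2 / (μ * Δt)) {φ : Fin (nx + 2) → Fin (ny + 2) → ℝ}
    (hφ : ∀ I J, 0 ≤ φ I J) {i j : ℕ} (hi : 1 ≤ i) (hinx : i ≤ nx) (hj : Odd j) (hjny : j ≤ ny)
    (hu : |h * u i j / (2 * μ)| ≤ 1) (hv : |h * v i j / (2 * μ)| ≤ 1) :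
    gridVal nx ny (AdInv2D nx ny h μ Δt (As2D nx ny h μ u v φ)) i j ≤
        -((1 + h * v i j / (2 * μ)) * gridVal nx ny φ i (j - 1) /
          (h ^ 2 / (μ * Δt) + 11 / 2)) ∧
      gridVal nx ny (AdInv2D nx ny h μ Δt (As2D nx ny h μ u v φ)) i j ≤
        -((1 - h * v i j / (2 * μ)) * gridVal nx ny φ i (j + 1) /
          (h ^ 2 / (μ * Δt) + 11 / 2)) := by
  obtain ⟨hu₁, hu₂⟩ := abs_le.1 hu
  obtain ⟨hv₁, hv₂⟩ := abs_le.1 hv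
  have hb : ¬ isBdry nx ny i j := by
    have := hj.pos
    unfold isBdry
    omega
  have n₁ : 0 ≤ (1 + h * u i j / (2 * μ)) * gridVal nx ny φ (i - 1) j :=
    mul_nonneg (by linarith) (gridVal_nonneg hφ _ _)
  have n₂ : 0 ≤ (1 - h * u i j / (2 * μ)) * gridVal nx ny φ (i + 1) j :=
    mul_nonneg (by linarith) (gridVal_nonneg hφ _ _)
  have n₃ : 0 ≤ (1 + h * v i j / (2 * μ)) * gridVal nx ny φ i (j - 1) :=
    mul_nonneg (by linarith) (gridVal_nonneg hφ _ _)
  have n₄ : 0 ≤ (1 - h * v i j / (2 * μ)) * gridVal nx ny φ i (j + 1) :=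
    mul_nonneg (by linarith) (gridVal_nonneg hφ _ _)
  rw [gridVal, dif_pos (by omega), dif_pos (by omega)]
  by_cases hio : Odd i
  · simp only [AdInv2D, As2D, if_neg hb, hio, hj, and_self, if_true]
    constructor <;> refine div_le_neg_div_of_le_neg ?_ ?_ ?_ ?_ <;> linarith
  · simp only [AdInv2D, As2D, if_neg hb, hio, hj, false_and, if_false, or_true, if_true]
    constructor <;> refine div_le_neg_div_of_le_neg ?_ ?_ ?_ ?_ <;> linarith

/-- Comparison of a single coefficient of `A_a⁺` with the corresponding coefficient of
`A^z A_d⁻¹ A^s`. -/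
theorem one_add_two_mul_div_four_le {a c p q : ℝ} (ha : 0 ≤ a) (hc : 0 < c)
    (hcond : 8 * a ^ 2 + (11 + 2 * c) * a + c ≤ 5 / 2) (hp : |p| ≤ a) (hq : |q| ≤ a) :
    (1 + 2 * p) / 4 ≤ 2 * (1 + p) * (1 + q) / (c + 11 / 2) := by
  obtain ⟨hp₁, hp₂⟩ := abs_le.1 hp
  obtain ⟨hq₁, hq₂⟩ := abs_le.1 hq
  have hac : 0 ≤ a * c := mul_nonneg ha hc.le
  have ha₁ : a ≤ 1 / 4 := by nlinarith
  have h₁ : (1 + p) * (1 - a) ≤ (1 + p) * (1 + q) :=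
    mul_le_mul_of_nonneg_left (by linarith) (by linarith)
  have h₂ : 0 ≤ (a - p) * (c + a + 3 / 2) := mul_nonneg (by linarith) (by linarith)
  have h₃ : 0 ≤ (a - p) * a := mul_nonneg (by linarith) ha
  rw [div_le_div_iff₀ (by norm_num) (by linarith)]
  nlinarith

/-- One-dimensional comparison along a grid line: the `A_a⁺` stencil is dominated by the `A^z`
stencil applied to values that are bounded above by the contributions of `A_d⁻¹ A^s`. -/
theorem stencil_le_of_le_neg_div {a c p q r x y w z : ℝ} (ha : 0 ≤ a) (hc : 0 < c)
    (hcond : 8 * a ^ 2 + (11 + 2 * c) * a + c ≤ 5 / 2)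
    (hp : |p| ≤ a) (hq : |q| ≤ a) (hr : |r| ≤ a) (hx : 0 ≤ x) (hy : 0 ≤ y)
    (hw : w ≤ -((1 + q) * x / (c + 11 / 2))) (hz : z ≤ -((1 - r) * y / (c + 11 / 2))) :
    (1 + 2 * p) / 4 * x + (1 - 2 * p) / 4 * y ≤ -2 * (1 + p) * w - 2 * (1 - p) * z := by
  have ha₁ : a ≤ 1 := by nlinarith [mul_nonneg ha hc.le]
  obtain ⟨hp₁, hp₂⟩ := abs_le.1 hp
  have e₁ := mul_le_mul_of_nonneg_right (one_add_two_mul_div_four_le ha hc hcond hp hq) hx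
  have e₂ := mul_le_mul_of_nonneg_right (one_add_two_mul_div_four_le ha hc hcond
    (p := -p) (q := -r) (by rwa [abs_neg]) (by rwa [abs_neg])) hy
  have f₁ := mul_le_mul_of_nonneg_left hw (show 0 ≤ 2 * (1 + p) by linarith)
  have f₂ := mul_le_mul_of_nonneg_left hz (show 0 ≤ 2 * (1 - p) by linarith)
  have g₁ : 2 * (1 + p) * (1 + q) / (c + 11 / 2) * x =
      2 * (1 + p) * ((1 + q) * x / (c + 11 / 2)) := by ring
  have g₂ : 2 * (1 + -p) * (1 + -r) / (c + 11 / 2) * y =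
      2 * (1 - p) * ((1 - r) * y / (c + 11 / 2)) := by ring
  linarith

/-- Sections 3.5.3 and 3.5.4 of the paper: with
`a = (h/(2μ))·max_{interior} max(|uᵢⱼ|, |vᵢⱼ|)` and `c = h²/(μΔt) > 0`, if
`8a² + (11 + 2c)a + c ≤ 5/2` then the entrywise inequality `A_a⁺ ≤ A^z A_d⁻¹ A^s` holds:
every matrix entry (w.r.t. the standard basis of grid arrays) of the composition
`A^z ∘ A_d⁻¹ ∘ A^s` dominates the corresponding entry of `A_a⁺`. -/
theorem Ap2D_le_Az2D_AdInv2D_As2D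
    (nx ny : ℕ) (hnx : Odd nx) (hny : Odd ny) (hnx3 : 3 ≤ nx) (hny3 : 3 ≤ ny)
    (h μ Δt : ℝ) (hh : 0 < h) (hμ : 0 < μ) (hΔt : 0 < Δt)
    (u v : ℕ → ℕ → ℝ) (m a : ℝ)
    (hm : IsGreatest {x : ℝ | ∃ i j : ℕ, 1 ≤ i ∧ i ≤ nx ∧ 1 ≤ j ∧ j ≤ ny ∧
      x = max |u i j| |v i j|} m)
    (ha : a = h / (2 * μ) * m)
    (hcond : 8 * a ^ 2 + (11 + 2 * (h ^ 2 / (μ * Δt))) * a + h ^ 2 / (μ * Δt) ≤ 5 / 2) :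
    ∀ (I : Fin (nx + 2)) (J : Fin (ny + 2)) (K : Fin (nx + 2)) (L : Fin (ny + 2)),
      Ap2D nx ny h μ u v (gridBasis nx ny K L) I J ≤
        Az2D nx ny h μ u v (AdInv2D nx ny h μ Δt (As2D nx ny h μ u v (gridBasis nx ny K L))) I J := by
  intro I J K L
  have hc : 0 < h ^ 2 / (μ * Δt) := by positivity
  have hbound : ∀ i j : ℕ, 1 ≤ i → i ≤ nx → 1 ≤ j → j ≤ ny →
      |h * u i j / (2 * μ)| ≤ a ∧ |h * v i j / (2 * μ)| ≤ a := by
    intro i j h1 h2 h3 h4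
    have hmax := hm.2 ⟨i, j, h1, h2, h3, h4, rfl⟩
    have hk : 0 < h / (2 * μ) := by positivity
    have scale : ∀ t : ℝ, |t| ≤ m → |h * t / (2 * μ)| ≤ a := by
      intro t ht
      rw [ha, mul_div_right_comm, abs_mul, abs_of_pos hk]
      exact mul_le_mul_of_nonneg_left ht hk.le
    exact ⟨scale _ ((le_max_left _ _).trans hmax), scale _ ((le_max_right _ _).trans hmax)⟩
  have ha₀ : 0 ≤ a :=
    (abs_nonneg _).trans (hbound 1 1 le_rfl (by omega) le_rfl (by omega)).1
  have ha₁ : a ≤ 1 := by nlinarith [mul_nonneg ha₀ hc.le]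
  have hφ := gridBasis_nonneg nx ny K L
  generalize gridBasis nx ny K L = φ at hφ
  have two_mul_half : ∀ t : ℝ, h * t / μ = 2 * (h * t / (2 * μ)) := by
    intro t
    field_simp
  obtain ⟨i, hi⟩ := I
  obtain ⟨j, hj⟩ := J
  have horizontal : ¬ isBdry nx ny i j → ¬ Odd i →
      (1 + 2 * (h * u i j / (2 * μ))) / 4 * gridVal nx ny φ (i - 2) j +
          (1 - 2 * (h * u i j / (2 * μ))) / 4 * gridVal nx ny φ (i + 2) j ≤
        -2 * (1 + h * u i j / (2 * μ)) *
            gridVal nx ny (AdInv2D nx ny h μ Δt (As2D nx ny h μ u v φ)) (i - 1) j -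
          2 * (1 - h * u i j / (2 * μ)) *
            gridVal nx ny (AdInv2D nx ny h μ Δt (As2D nx ny h μ u v φ)) (i + 1) j := by
    intro hb hio
    simp only [isBdry, not_or] at hb
    have ho₁ : Odd (i - 1) := by grind
    have ho₂ : Odd (i + 1) := by grind
    have hlt : i + 1 ≤ nx := by grind
    obtain ⟨b₁, d₁⟩ := hbound (i - 1) j ho₁.pos (by omega) (by omega) (by omega)
    obtain ⟨b₂, d₂⟩ := hbound (i + 1) j (by omega) hlt (by omega) (by omega)
    exact stencil_le_of_le_neg_div ha₀ hc hcond
      (hbound i j (by omega) (by omega) (by omega) (by omega)).1 b₁ b₂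
      (gridVal_nonneg hφ _ _) (gridVal_nonneg hφ _ _)
      (gridVal_AdInv2D_As2D_le_of_odd_left hc hφ ho₁ (by omega) (by omega) (by omega)
        (b₁.trans ha₁) (d₁.trans ha₁)).1
      (gridVal_AdInv2D_As2D_le_of_odd_left hc hφ ho₂ hlt (by omega) (by omega)
        (b₂.trans ha₁) (d₂.trans ha₁)).2
  have vertical : ¬ isBdry nx ny i j → ¬ Odd j →
      (1 + 2 * (h * v i j / (2 * μ))) / 4 * gridVal nx ny φ i (j - 2) +
          (1 - 2 * (h * v i j / (2 * μ))) / 4 * gridVal nx ny φ i (j + 2) ≤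
        -2 * (1 + h * v i j / (2 * μ)) *
            gridVal nx ny (AdInv2D nx ny h μ Δt (As2D nx ny h μ u v φ)) i (j - 1) -
          2 * (1 - h * v i j / (2 * μ)) *
            gridVal nx ny (AdInv2D nx ny h μ Δt (As2D nx ny h μ u v φ)) i (j + 1) := by
    intro hb hjo
    simp only [isBdry, not_or] at hb
    have ho₁ : Odd (j - 1) := by grind
    have ho₂ : Odd (j + 1) := by grind
    have hlt : j + 1 ≤ ny := by grind
    obtain ⟨b₁, d₁⟩ := hbound i (j - 1) (by omega) (by omega) ho₁.pos (by omega)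
    obtain ⟨b₂, d₂⟩ := hbound i (j + 1) (by omega) (by omega) (by omega) hlt
    exact stencil_le_of_le_neg_div ha₀ hc hcond
      (hbound i j (by omega) (by omega) (by omega) (by omega)).2 d₁ d₂
      (gridVal_nonneg hφ _ _) (gridVal_nonneg hφ _ _)
      (gridVal_AdInv2D_As2D_le_of_odd_right hc hφ (by omega) (by omega) ho₁ (by omega)
        (b₁.trans ha₁) (d₁.trans ha₁)).1
      (gridVal_AdInv2D_As2D_le_of_odd_right hc hφ (by omega) (by omega) ho₂ hlt
        (b₂.trans ha₁) (d₂.trans ha₁)).2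
  simp only [Ap2D, Az2D, two_mul_half]
  split_ifs with hb hoo hio hjo
  · exact le_rfl
  · exact le_rfl
  · exact vertical hb fun hjo => hoo ⟨hio, hjo⟩
  · exact horizontal hb hio
  · linarith [horizontal hb hio, vertical hb hjo]
end

section
/- (Discrete maximum principle for the 2D fourth-order backward-Euler scheme.) Set a = (h/(2μ))·‖(u,v)‖_∞ and assume a < (√201 − 11)/16 and Δt·μ/h² ≥ (2a + 1)/(5/2 − 11a − 8a²). Let b be any real array indexed by the grid indices. Then there is a unique array φ with Aφ = c·b (equivalently L̄φ = b with L̄ = (1/c)A), and every entry of φ satisfies min_{(k,l)} b_{k,l} ≤ φ_{i,j} ≤ max_{(k,l)} b_{k,l}, where the min and max are taken over all grid indices. -/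
/-- The scaled 2D fourth-order scheme operator `A = (h²/(μΔt))·L̄` with `c = h²/(μΔt)`:
`(Aφ)ᵢⱼ = c·φᵢⱼ` at boundary indices; at interior indices the fourth-order finite
difference discretization of `c + (h²/μ)(u∂ₓ + v∂_y - μΔ)` obtained from the `Q²`
spectral element method, with the cell-center, x-edge-center, y-edge-center and knot
stencils depending on the parities of `i` and `j`. -/
noncomputable def schemeA2D (nx ny : ℕ) (h μ Δt : ℝ) (u v : ℕ → ℕ → ℝ)
    (φ : Fin (nx + 2) → Fin (ny + 2) → ℝ) (I : Fin (nx + 2)) (J : Fin (ny + 2)) : ℝ :=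
  let c := h ^ 2 / (μ * Δt)
  let i := (I : ℕ)
  let j := (J : ℕ)
  let ψ := gridVal nx ny φ
  if isBdry nx ny i j then c * φ I J
  else if Odd i ∧ Odd j then
    -- cell center
    c * ψ i j + h * u i j / (2 * μ) * (ψ (i + 1) j - ψ (i - 1) j)
      + h * v i j / (2 * μ) * (ψ i (j + 1) - ψ i (j - 1))
      + (-ψ (i - 1) j + 2 * ψ i j - ψ (i + 1) j)
      + (-ψ i (j - 1) + 2 * ψ i j - ψ i (j + 1))
  else if Odd i then
    -- x-edge center (edge parallel to the x-axis): `i` odd, `j` even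
    c * ψ i j + h * u i j / (2 * μ) * (ψ (i + 1) j - ψ (i - 1) j)
      + h * v i j / (4 * μ) * (ψ i (j - 2) - 4 * ψ i (j - 1) + 4 * ψ i (j + 1) - ψ i (j + 2))
      + (-ψ (i - 1) j + 2 * ψ i j - ψ (i + 1) j)
      + (ψ i (j - 2) - 8 * ψ i (j - 1) + 14 * ψ i j - 8 * ψ i (j + 1) + ψ i (j + 2)) / 4
  else if Odd j then
    -- y-edge center (edge parallel to the y-axis): `i` even, `j` odd
    c * ψ i j + h * u i j / (4 * μ) * (ψ (i - 2) j - 4 * ψ (i - 1) j + 4 * ψ (i + 1) j - ψ (i + 2) j)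
      + h * v i j / (2 * μ) * (ψ i (j + 1) - ψ i (j - 1))
      + (ψ (i - 2) j - 8 * ψ (i - 1) j + 14 * ψ i j - 8 * ψ (i + 1) j + ψ (i + 2) j) / 4
      + (-ψ i (j - 1) + 2 * ψ i j - ψ i (j + 1))
  else
    -- interior knot: `i` and `j` both even
    c * ψ i j + h * u i j / (4 * μ) * (ψ (i - 2) j - 4 * ψ (i - 1) j + 4 * ψ (i + 1) j - ψ (i + 2) j)
      + h * v i j / (4 * μ) * (ψ i (j - 2) - 4 * ψ i (j - 1) + 4 * ψ i (j + 1) - ψ i (j + 2))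
      + (ψ (i - 2) j - 8 * ψ (i - 1) j + 14 * ψ i j - 8 * ψ (i + 1) j + ψ (i + 2) j) / 4
      + (ψ i (j - 2) - 8 * ψ i (j - 1) + 14 * ψ i j - 8 * ψ i (j + 1) + ψ i (j + 2)) / 4

namespace SchemeA2D

section Scalar

variable {a d α β X Y : ℝ}

/-- A distance-two weight is dominated by the distance-one weight times the normalized weight
linking the intermediate node to the far one. -/
lemma far_le_near (ha : a < 1 / 2) (hβ : |β| ≤ a) (hd : 0 < d)
    (hda : d * (1 + 2 * a) ≤ 8 * (1 - a ^ 2)) (hY : 0 ≤ Y) (h : (1 - a) * Y ≤ d * X) :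
    (1 / 4 + β / 2) * Y ≤ (2 + 2 * β) * X := by
  obtain ⟨h1, h2⟩ := abs_le.1 hβ
  have hw : d * (1 + 2 * β) ≤ 8 * (1 + β) * (1 - a) := by
    have e1 : d * (1 + 2 * a) * (1 + 2 * β) ≤ 8 * (1 - a ^ 2) * (1 + 2 * β) :=
      mul_le_mul_of_nonneg_right hda (by linarith)
    have e2 : 0 ≤ (1 - a) * (a - β) := mul_nonneg (by linarith) (by linarith)
    refine le_of_mul_le_mul_right (a := 1 + 2 * a) ?_ (by linarith)
    nlinarith
  have e3 := mul_le_mul_of_nonneg_right hw hY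
  have e4 := mul_le_mul_of_nonneg_left h (by linarith : 0 ≤ 2 + 2 * β)
  refine le_of_mul_le_mul_left (a := d) ?_ hd
  linarith

/-- The three-point stencil at odd positions. -/
noncomputable def shortStencil (α x₀ x₁ x₂ : ℝ) : ℝ := α * (x₂ - x₀) + (-x₀ + 2 * x₁ - x₂)

/-- The five-point stencil at even positions. -/
noncomputable def longStencil (α x₀ x₁ x₂ x₃ x₄ : ℝ) : ℝ :=
  α / 2 * (x₀ - 4 * x₁ + 4 * x₃ - x₄) + (x₀ - 8 * x₁ + 14 * x₂ - 8 * x₃ + x₄) / 4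

variable {x₀ x₁ x₂ x₃ x₄ : ℝ}

lemma shortStencil_le (hα : |α| ≤ a) (h₀ : 0 ≤ x₀) (h₂ : 0 ≤ x₂) :
    shortStencil α x₀ x₁ x₂ ≤ 2 * x₁ - (1 - a) * x₀ - (1 - a) * x₂ := by
  obtain ⟨h1, h2⟩ := abs_le.1 hα
  unfold shortStencil
  have e1 := mul_nonneg (by linarith : 0 ≤ a + α) h₀
  have e2 := mul_nonneg (by linarith : 0 ≤ a - α) h₂
  linarith

lemma longStencil_le (ha : a < 1 / 2) (hα : |α| ≤ a) (hd : 0 < d)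
    (hda : d * (1 + 2 * a) ≤ 8 * (1 - a ^ 2)) (h₀ : 0 ≤ x₀) (h₄ : 0 ≤ x₄)
    (h₁ : (1 - a) * x₀ ≤ d * x₁) (h₃ : (1 - a) * x₄ ≤ d * x₃) :
    longStencil α x₀ x₁ x₂ x₃ x₄ ≤ 7 / 2 * x₂ := by
  have e1 := far_le_near ha hα hd hda h₀ h₁
  have e2 := far_le_near ha (by rwa [abs_neg] : |-α| ≤ a) hd hda h₄ h₃
  unfold longStencil
  linarith

end Scalar

section Grid

variable {nx ny : ℕ} {h μ Δt : ℝ} {u v : ℕ → ℕ → ℝ} {φ χ : Fin (nx + 2) → Fin (ny + 2) → ℝ}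

lemma gridVal_nonneg (hφ : ∀ I J, 0 ≤ φ I J) (i j : ℕ) : 0 ≤ gridVal nx ny φ i j := by
  unfold gridVal
  split_ifs <;> first | exact hφ _ _ | exact le_rfl

lemma gridVal_coe (I : Fin (nx + 2)) (J : Fin (ny + 2)) : gridVal nx ny φ I J = φ I J := by
  simp [gridVal]

lemma gridVal_add (i j : ℕ) :
    gridVal nx ny (φ + χ) i j = gridVal nx ny φ i j + gridVal nx ny χ i j := by
  unfold gridVal
  split_ifs <;> simp

lemma gridVal_smul (t : ℝ) (i j : ℕ) :
    gridVal nx ny (t • φ) i j = t * gridVal nx ny φ i j := by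
  unfold gridVal
  split_ifs <;> simp

lemma gridVal_const (t : ℝ) {i j : ℕ} (hi : i < nx + 2) (hj : j < ny + 2) :
    gridVal nx ny (fun _ _ => t) i j = t := by
  simp [gridVal, hi, hj]

variable (nx ny h μ Δt u v) in
/-- The scheme operator as a linear endomorphism of the space of grid arrays. -/
noncomputable def operator :
    (Fin (nx + 2) → Fin (ny + 2) → ℝ) →ₗ[ℝ] (Fin (nx + 2) → Fin (ny + 2) → ℝ) where
  toFun := schemeA2D nx ny h μ Δt u v
  map_add' φ χ := by
    funext I J
    simp only [schemeA2D, gridVal_add, Pi.add_apply]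
    split_ifs <;> ring
  map_smul' t φ := by
    funext I J
    simp only [schemeA2D, gridVal_smul, Pi.smul_apply, smul_eq_mul, RingHom.id_apply]
    split_ifs <;> ring

lemma operator_apply (φ) : operator nx ny h μ Δt u v φ = schemeA2D nx ny h μ Δt u v φ := rfl

lemma operator_const (hnx : Odd nx) (hny : Odd ny) (t : ℝ) :
    operator nx ny h μ Δt u v (fun _ _ => t) = fun _ _ => h ^ 2 / (μ * Δt) * t := by
  funext I J
  obtain ⟨i, hi⟩ := I
  obtain ⟨j, hj⟩ := J
  simp only [operator_apply, schemeA2D, isBdry]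
  rw [Nat.odd_iff] at hnx hny
  simp only [Nat.odd_iff]
  split_ifs with h0 h1 h2 h3 <;> first | rfl | skip
  all_goals
    simp only [not_or, not_and] at *
    repeat rw [gridVal_const t (by omega) (by omega)]
    ring

variable {i j : ℕ}

lemma schemeA2D_center (hi : Even i) (hj : Even j) (hix : i + 1 ≤ nx) (hjy : j + 1 ≤ ny) :
    schemeA2D nx ny h μ Δt u v φ ⟨i + 1, by omega⟩ ⟨j + 1, by omega⟩ =
      h ^ 2 / (μ * Δt) * gridVal nx ny φ (i + 1) (j + 1) +
      shortStencil (h / (2 * μ) * u (i + 1) (j + 1)) (gridVal nx ny φ i (j + 1))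
        (gridVal nx ny φ (i + 1) (j + 1)) (gridVal nx ny φ (i + 2) (j + 1)) +
      shortStencil (h / (2 * μ) * v (i + 1) (j + 1)) (gridVal nx ny φ (i + 1) j)
        (gridVal nx ny φ (i + 1) (j + 1)) (gridVal nx ny φ (i + 1) (j + 2)) := by
  simp only [schemeA2D, shortStencil]
  rw [if_neg (by unfold isBdry; omega), if_pos ⟨hi.add_one, hj.add_one⟩]
  simp only [Nat.add_sub_cancel, add_assoc, Nat.reduceAdd]
  ring

lemma schemeA2D_xEdge (hi : Even i) (hj : Even j) (hix : i + 1 ≤ nx) (hjy : j + 2 ≤ ny) :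
    schemeA2D nx ny h μ Δt u v φ ⟨i + 1, by omega⟩ ⟨j + 2, by omega⟩ =
      h ^ 2 / (μ * Δt) * gridVal nx ny φ (i + 1) (j + 2) +
      shortStencil (h / (2 * μ) * u (i + 1) (j + 2)) (gridVal nx ny φ i (j + 2))
        (gridVal nx ny φ (i + 1) (j + 2)) (gridVal nx ny φ (i + 2) (j + 2)) +
      longStencil (h / (2 * μ) * v (i + 1) (j + 2)) (gridVal nx ny φ (i + 1) j)
        (gridVal nx ny φ (i + 1) (j + 1)) (gridVal nx ny φ (i + 1) (j + 2))
        (gridVal nx ny φ (i + 1) (j + 3)) (gridVal nx ny φ (i + 1) (j + 4)) := by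
  have hj' : ¬ Odd (j + 2) := by rw [Nat.not_odd_iff_even]; exact hj.add even_two
  simp only [schemeA2D, shortStencil, longStencil]
  rw [if_neg (by unfold isBdry; omega), if_neg (fun H => hj' H.2), if_pos hi.add_one]
  simp only [Nat.add_sub_cancel, add_assoc, Nat.reduceAdd, show j + 2 - 1 = j + 1 from rfl]
  ring

lemma schemeA2D_yEdge (hi : Even i) (hj : Even j) (hix : i + 2 ≤ nx) (hjy : j + 1 ≤ ny) :
    schemeA2D nx ny h μ Δt u v φ ⟨i + 2, by omega⟩ ⟨j + 1, by omega⟩ =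
      h ^ 2 / (μ * Δt) * gridVal nx ny φ (i + 2) (j + 1) +
      longStencil (h / (2 * μ) * u (i + 2) (j + 1)) (gridVal nx ny φ i (j + 1))
        (gridVal nx ny φ (i + 1) (j + 1)) (gridVal nx ny φ (i + 2) (j + 1))
        (gridVal nx ny φ (i + 3) (j + 1)) (gridVal nx ny φ (i + 4) (j + 1)) +
      shortStencil (h / (2 * μ) * v (i + 2) (j + 1)) (gridVal nx ny φ (i + 2) j)
        (gridVal nx ny φ (i + 2) (j + 1)) (gridVal nx ny φ (i + 2) (j + 2)) := by
  have hi' : ¬ Odd (i + 2) := by rw [Nat.not_odd_iff_even]; exact hi.add even_two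
  simp only [schemeA2D, shortStencil, longStencil]
  rw [if_neg (by unfold isBdry; omega), if_neg (fun H => hi' H.1), if_neg hi',
    if_pos hj.add_one]
  simp only [Nat.add_sub_cancel, add_assoc, Nat.reduceAdd, show i + 2 - 1 = i + 1 from rfl]
  ring

lemma schemeA2D_knot (hi : Even i) (hj : Even j) (hix : i + 2 ≤ nx) (hjy : j + 2 ≤ ny) :
    schemeA2D nx ny h μ Δt u v φ ⟨i + 2, by omega⟩ ⟨j + 2, by omega⟩ =
      h ^ 2 / (μ * Δt) * gridVal nx ny φ (i + 2) (j + 2) +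
      longStencil (h / (2 * μ) * u (i + 2) (j + 2)) (gridVal nx ny φ i (j + 2))
        (gridVal nx ny φ (i + 1) (j + 2)) (gridVal nx ny φ (i + 2) (j + 2))
        (gridVal nx ny φ (i + 3) (j + 2)) (gridVal nx ny φ (i + 4) (j + 2)) +
      longStencil (h / (2 * μ) * v (i + 2) (j + 2)) (gridVal nx ny φ (i + 2) j)
        (gridVal nx ny φ (i + 2) (j + 1)) (gridVal nx ny φ (i + 2) (j + 2))
        (gridVal nx ny φ (i + 2) (j + 3)) (gridVal nx ny φ (i + 2) (j + 4)) := by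
  have hi' : ¬ Odd (i + 2) := by rw [Nat.not_odd_iff_even]; exact hi.add even_two
  have hj' : ¬ Odd (j + 2) := by rw [Nat.not_odd_iff_even]; exact hj.add even_two
  simp only [schemeA2D, longStencil]
  rw [if_neg (by unfold isBdry; omega), if_neg (fun H => hi' H.1), if_neg hi', if_neg hj']
  simp only [Nat.add_sub_cancel, add_assoc, Nat.reduceAdd, show i + 2 - 1 = i + 1 from rfl,
    show j + 2 - 1 = j + 1 from rfl]
  ring

/-- The discretization parameters for which the scheme is monotone. -/
structure Admissible (nx ny : ℕ) (h μ Δt : ℝ) (u v : ℕ → ℕ → ℝ) (a : ℝ) : Prop where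
  odd_nx : Odd nx
  odd_ny : Odd ny
  nonneg : 0 ≤ a
  lt_half : a < 1 / 2
  scale_pos : 0 < h ^ 2 / (μ * Δt)
  scale_le : (h ^ 2 / (μ * Δt) + 11 / 2) * (1 + 2 * a) ≤ 8 * (1 - a ^ 2)
  abs_u_le : ∀ i j, 1 ≤ i → i ≤ nx → 1 ≤ j → j ≤ ny → |h / (2 * μ) * u i j| ≤ a
  abs_v_le : ∀ i j, 1 ≤ i → i ≤ nx → 1 ≤ j → j ≤ ny → |h / (2 * μ) * v i j| ≤ a

namespace Admissible

variable {a : ℝ}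

lemma scale_add_four_le (P : Admissible nx ny h μ Δt u v a) :
    (h ^ 2 / (μ * Δt) + 4) * (1 + 2 * a) ≤ 8 * (1 - a ^ 2) := by
  nlinarith [P.scale_le, P.nonneg]

lemma center_bound (P : Admissible nx ny h μ Δt u v a) (hφ : ∀ I J, 0 ≤ φ I J)
    (hA : ∀ I J, 0 < schemeA2D nx ny h μ Δt u v φ I J) (hi : Even i) (hj : Even j)
    (hix : i + 1 ≤ nx) (hjy : j + 1 ≤ ny) :
    (1 - a) * gridVal nx ny φ i (j + 1) + (1 - a) * gridVal nx ny φ (i + 2) (j + 1) +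
      (1 - a) * gridVal nx ny φ (i + 1) j + (1 - a) * gridVal nx ny φ (i + 1) (j + 2) <
      (h ^ 2 / (μ * Δt) + 4) * gridVal nx ny φ (i + 1) (j + 1) := by
  have g := gridVal_nonneg hφ
  have := hA ⟨i + 1, by omega⟩ ⟨j + 1, by omega⟩
  rw [schemeA2D_center hi hj hix hjy] at this
  have e1 := shortStencil_le (x₁ := gridVal nx ny φ (i + 1) (j + 1))
    (P.abs_u_le (i + 1) (j + 1) (by omega) hix (by omega) hjy) (g i (j + 1)) (g (i + 2) (j + 1))
  have e2 := shortStencil_le (x₁ := gridVal nx ny φ (i + 1) (j + 1))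
    (P.abs_v_le (i + 1) (j + 1) (by omega) hix (by omega) hjy) (g (i + 1) j) (g (i + 1) (j + 2))
  linarith

lemma center_bound_each (P : Admissible nx ny h μ Δt u v a) (hφ : ∀ I J, 0 ≤ φ I J)
    (hA : ∀ I J, 0 < schemeA2D nx ny h μ Δt u v φ I J) (hi : Even i) (hj : Even j)
    (hix : i + 1 ≤ nx) (hjy : j + 1 ≤ ny) :
    (1 - a) * gridVal nx ny φ i (j + 1) ≤
        (h ^ 2 / (μ * Δt) + 4) * gridVal nx ny φ (i + 1) (j + 1) ∧
      (1 - a) * gridVal nx ny φ (i + 2) (j + 1) ≤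
        (h ^ 2 / (μ * Δt) + 4) * gridVal nx ny φ (i + 1) (j + 1) ∧
      (1 - a) * gridVal nx ny φ (i + 1) j ≤
        (h ^ 2 / (μ * Δt) + 4) * gridVal nx ny φ (i + 1) (j + 1) ∧
      (1 - a) * gridVal nx ny φ (i + 1) (j + 2) ≤
        (h ^ 2 / (μ * Δt) + 4) * gridVal nx ny φ (i + 1) (j + 1) := by
  have g k l : 0 ≤ (1 - a) * gridVal nx ny φ k l :=
    mul_nonneg (by linarith [P.lt_half]) (gridVal_nonneg hφ k l)
  have := P.center_bound hφ hA hi hj hix hjy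
  refine ⟨?_, ?_, ?_, ?_⟩ <;>
    linarith [g i (j + 1), g (i + 2) (j + 1), g (i + 1) j, g (i + 1) (j + 2)]

lemma xEdge_bound (P : Admissible nx ny h μ Δt u v a) (hφ : ∀ I J, 0 ≤ φ I J)
    (hA : ∀ I J, 0 < schemeA2D nx ny h μ Δt u v φ I J) (hi : Even i) (hj : Even j)
    (hix : i + 1 ≤ nx) (hjy : j + 2 ≤ ny) :
    (1 - a) * gridVal nx ny φ i (j + 2) + (1 - a) * gridVal nx ny φ (i + 2) (j + 2) <
      (h ^ 2 / (μ * Δt) + 11 / 2) * gridVal nx ny φ (i + 1) (j + 2) := by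
  have g := gridVal_nonneg hφ
  have hjy' : j + 2 + 1 ≤ ny := by have := P.odd_ny; rw [Nat.odd_iff] at this; grind
  have := hA ⟨i + 1, by omega⟩ ⟨j + 2, by omega⟩
  rw [schemeA2D_xEdge hi hj hix hjy] at this
  have e1 := shortStencil_le (x₁ := gridVal nx ny φ (i + 1) (j + 2))
    (P.abs_u_le (i + 1) (j + 2) (by omega) hix (by omega) hjy) (g i (j + 2)) (g (i + 2) (j + 2))
  have e2 := longStencil_le (x₂ := gridVal nx ny φ (i + 1) (j + 2)) P.lt_half
    (P.abs_v_le (i + 1) (j + 2) (by omega) hix (by omega) hjy) (by linarith [P.scale_pos])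
    P.scale_add_four_le (g (i + 1) j) (g (i + 1) (j + 4))
    (P.center_bound_each hφ hA hi hj hix (by omega)).2.2.1
    (P.center_bound_each hφ hA hi (hj.add even_two) hix hjy').2.2.2
  linarith

lemma yEdge_bound (P : Admissible nx ny h μ Δt u v a) (hφ : ∀ I J, 0 ≤ φ I J)
    (hA : ∀ I J, 0 < schemeA2D nx ny h μ Δt u v φ I J) (hi : Even i) (hj : Even j)
    (hix : i + 2 ≤ nx) (hjy : j + 1 ≤ ny) :
    (1 - a) * gridVal nx ny φ (i + 2) j + (1 - a) * gridVal nx ny φ (i + 2) (j + 2) <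
      (h ^ 2 / (μ * Δt) + 11 / 2) * gridVal nx ny φ (i + 2) (j + 1) := by
  have g := gridVal_nonneg hφ
  have hix' : i + 2 + 1 ≤ nx := by have := P.odd_nx; rw [Nat.odd_iff] at this; grind
  have := hA ⟨i + 2, by omega⟩ ⟨j + 1, by omega⟩
  rw [schemeA2D_yEdge hi hj hix hjy] at this
  have e1 := shortStencil_le (x₁ := gridVal nx ny φ (i + 2) (j + 1))
    (P.abs_v_le (i + 2) (j + 1) (by omega) hix (by omega) hjy) (g (i + 2) j) (g (i + 2) (j + 2))
  have e2 := longStencil_le (x₂ := gridVal nx ny φ (i + 2) (j + 1)) P.lt_half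
    (P.abs_u_le (i + 2) (j + 1) (by omega) hix (by omega) hjy) (by linarith [P.scale_pos])
    P.scale_add_four_le (g i (j + 1)) (g (i + 4) (j + 1))
    (P.center_bound_each hφ hA hi hj (by omega) hjy).1
    (P.center_bound_each hφ hA (hi.add even_two) hj hix' hjy).2.1
  linarith

lemma knot_bound (P : Admissible nx ny h μ Δt u v a) (hφ : ∀ I J, 0 ≤ φ I J)
    (hA : ∀ I J, 0 < schemeA2D nx ny h μ Δt u v φ I J) (hi : Even i) (hj : Even j)
    (hix : i + 2 ≤ nx) (hjy : j + 2 ≤ ny) :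
    0 < (h ^ 2 / (μ * Δt) + 7) * gridVal nx ny φ (i + 2) (j + 2) := by
  have g := gridVal_nonneg hφ
  have hix' : i + 2 + 1 ≤ nx := by have := P.odd_nx; rw [Nat.odd_iff] at this; grind
  have hjy' : j + 2 + 1 ≤ ny := by have := P.odd_ny; rw [Nat.odd_iff] at this; grind
  have := hA ⟨i + 2, by omega⟩ ⟨j + 2, by omega⟩
  rw [schemeA2D_knot hi hj hix hjy] at this
  have f k l : 0 ≤ (1 - a) * gridVal nx ny φ k l :=
    mul_nonneg (by linarith [P.lt_half]) (g k l)
  have west := P.xEdge_bound hφ hA hi hj (by omega) hjy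
  have east := P.xEdge_bound hφ hA (hi.add even_two) hj hix' hjy
  have south := P.yEdge_bound hφ hA hi hj hix (by omega)
  have north := P.yEdge_bound hφ hA hi (hj.add even_two) hix hjy'
  simp only [add_assoc, Nat.reduceAdd] at east north
  have hd : 0 < h ^ 2 / (μ * Δt) + 11 / 2 := by linarith [P.scale_pos]
  have e1 := longStencil_le (x₁ := gridVal nx ny φ (i + 1) (j + 2))
    (x₂ := gridVal nx ny φ (i + 2) (j + 2)) (x₃ := gridVal nx ny φ (i + 3) (j + 2)) P.lt_half
    (P.abs_u_le (i + 2) (j + 2) (by omega) hix (by omega) hjy) hd P.scale_le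
    (g i (j + 2)) (g (i + 4) (j + 2))
    (by linarith [f (i + 2) (j + 2)]) (by linarith [f (i + 2) (j + 2)])
  have e2 := longStencil_le (x₁ := gridVal nx ny φ (i + 2) (j + 1))
    (x₂ := gridVal nx ny φ (i + 2) (j + 2)) (x₃ := gridVal nx ny φ (i + 2) (j + 3)) P.lt_half
    (P.abs_v_le (i + 2) (j + 2) (by omega) hix (by omega) hjy) hd P.scale_le
    (g (i + 2) j) (g (i + 2) (j + 4))
    (by linarith [f (i + 2) (j + 2)]) (by linarith [f (i + 2) (j + 2)])
  linarith

/-- A nonnegative array with positive image is positive. -/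
lemma pos_of_nonneg (P : Admissible nx ny h μ Δt u v a) (hφ : ∀ I J, 0 ≤ φ I J)
    (hA : ∀ I J, 0 < schemeA2D nx ny h μ Δt u v φ I J) (I : Fin (nx + 2)) (J : Fin (ny + 2)) :
    0 < φ I J := by
  have hc := P.scale_pos
  by_cases hb : isBdry nx ny I J
  · have := hA I J
    simp only [schemeA2D, if_pos hb] at this
    exact pos_of_mul_pos_right this hc.le
  rw [← gridVal_coe (φ := φ) I J]
  have f k l : 0 ≤ (1 - a) * gridVal nx ny φ k l :=
    mul_nonneg (by linarith [P.lt_half]) (gridVal_nonneg hφ k l)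
  have key {k : ℕ} (hk : k ≠ 0) : ∃ l, Even l ∧ (k = l + 1 ∨ k = l + 2) := by
    rcases Nat.even_or_odd k with hk' | hk'
    · exact ⟨k - 2, by grind, by grind⟩
    · exact ⟨k - 1, by grind, by grind⟩
  obtain ⟨I, hI⟩ := I
  obtain ⟨J, hJ⟩ := J
  simp only [isBdry, not_or] at hb ⊢
  obtain ⟨i, hi, hI'⟩ := key hb.1
  obtain ⟨j, hj, hJ'⟩ := key hb.2.2.1
  rcases hI' with rfl | rfl <;> rcases hJ' with rfl | rfl
  · have := P.center_bound hφ hA hi hj (by omega) (by omega)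
    refine pos_of_mul_pos_right (a := h ^ 2 / (μ * Δt) + 4) ?_ (by linarith)
    linarith [f i (j + 1), f (i + 2) (j + 1), f (i + 1) j, f (i + 1) (j + 2)]
  · have := P.xEdge_bound hφ hA hi hj (by omega) (by omega)
    refine pos_of_mul_pos_right (a := h ^ 2 / (μ * Δt) + 11 / 2) ?_ (by linarith)
    linarith [f i (j + 2), f (i + 2) (j + 2)]
  · have := P.yEdge_bound hφ hA hi hj (by omega) (by omega)
    refine pos_of_mul_pos_right (a := h ^ 2 / (μ * Δt) + 11 / 2) ?_ (by linarith)
    linarith [f (i + 2) j, f (i + 2) (j + 2)]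
  · exact pos_of_mul_pos_right (P.knot_bound hφ hA hi hj (by omega) (by omega)) (by linarith)

/-- The scheme operator is inverse-positive. -/
lemma nonneg_of_operator_nonneg (P : Admissible nx ny h μ Δt u v a)
    (hA : 0 ≤ operator nx ny h μ Δt u v φ) : 0 ≤ φ := by
  obtain ⟨⟨I, J⟩, hmin⟩ := Finite.exists_min fun p : Fin (nx + 2) × Fin (ny + 2) => φ p.1 p.2
  by_contra hneg
  have hm : φ I J < 0 := by
    by_contra! hm
    exact hneg fun K L => hm.trans (hmin (K, L))
  have hw : ∀ K L, 0 < schemeA2D nx ny h μ Δt u v (φ - fun _ _ => φ I J) K L := by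
    intro K L
    rw [← operator_apply, map_sub, operator_const P.odd_nx P.odd_ny]
    have := hA K L
    have := mul_neg_of_pos_of_neg P.scale_pos hm
    simp only [Pi.sub_apply, Pi.zero_apply] at *
    linarith
  have := P.pos_of_nonneg (fun K L => sub_nonneg.2 (hmin (K, L))) hw I J
  simp at this

lemma le_of_operator_le (P : Admissible nx ny h μ Δt u v a)
    (hA : operator nx ny h μ Δt u v φ ≤ operator nx ny h μ Δt u v χ) : φ ≤ χ := by
  rw [← sub_nonneg] at hA ⊢
  rw [← map_sub] at hA
  exact P.nonneg_of_operator_nonneg hA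

lemma operator_injective (P : Admissible nx ny h μ Δt u v a) :
    Function.Injective (operator nx ny h μ Δt u v) := fun _ _ H =>
  le_antisymm (P.le_of_operator_le H.le) (P.le_of_operator_le H.ge)

end Admissible

end Grid

lemma admissible {nx ny : ℕ} (hnx : Odd nx) (hny : Odd ny) {h μ Δt : ℝ} (hh : 0 < h) (hμ : 0 < μ)
    (hΔt : 0 < Δt) {u v : ℕ → ℕ → ℝ} {m a : ℝ}
    (hm : IsGreatest {x : ℝ | ∃ i j : ℕ, 1 ≤ i ∧ i ≤ nx ∧ 1 ≤ j ∧ j ≤ ny ∧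
      x = max |u i j| |v i j|} m)
    (ha : a = h / (2 * μ) * m) (ha' : a < (Real.sqrt 201 - 11) / 16)
    (hdt : Δt * μ / h ^ 2 ≥ (2 * a + 1) / (5 / 2 - 11 * a - 8 * a ^ 2)) :
    Admissible nx ny h μ Δt u v a := by
  have hk : 0 < h / (2 * μ) := by positivity
  have hm0 : 0 ≤ m := by
    obtain ⟨i, j, -, -, -, -, rfl⟩ := hm.1
    exact (abs_nonneg _).trans (le_max_left _ _)
  have ha0 : 0 ≤ a := ha ▸ mul_nonneg hk.le hm0
  have hs := Real.sq_sqrt (show (0 : ℝ) ≤ 201 by norm_num)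
  have hsq : (16 * a + 11) ^ 2 < 201 := by
    rw [← hs]
    exact pow_lt_pow_left₀ (by linarith) (by linarith) two_ne_zero
  have hD : 0 < 5 / 2 - 11 * a - 8 * a ^ 2 := by linarith
  have hbound {w : ℕ → ℕ → ℝ} {i j : ℕ} (hw : |w i j| ≤ max |u i j| |v i j|) (h1 : 1 ≤ i)
      (h2 : i ≤ nx) (h3 : 1 ≤ j) (h4 : j ≤ ny) : |h / (2 * μ) * w i j| ≤ a := by
    rw [abs_mul, abs_of_pos hk, ha]
    exact mul_le_mul_of_nonneg_left (hw.trans (hm.2 ⟨i, j, h1, h2, h3, h4, rfl⟩)) hk.le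
  refine ⟨hnx, hny, ha0, by nlinarith, by positivity, ?_,
    fun i j => hbound (le_max_left _ _), fun i j => hbound (le_max_right _ _)⟩
  have hc : h ^ 2 / (μ * Δt) * (1 + 2 * a) ≤ 5 / 2 - 11 * a - 8 * a ^ 2 := by
    rw [ge_iff_le, div_le_div_iff₀ hD (by positivity)] at hdt
    rw [div_mul_eq_mul_div, div_le_iff₀ (by positivity)]
    linarith
  linarith

end SchemeA2D

/-- Discrete maximum principle for the 2D fourth-order backward-Euler scheme
(Theorem 3.2 combined with Theorem 3.8 in the paper): with `a = (h/(2μ))·‖(u,v)‖_∞`, if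
`a < (√201 - 11)/16` and `Δt·μ/h² ≥ (2a+1)/(5/2 - 11a - 8a²)`, then for any data array
`b` there is a unique `φ` with `Aφ = c·b` (i.e. `L̄φ = b`), and every entry of `φ` lies
between the minimal and the maximal entry of `b`. -/
theorem schemeA2D_discrete_maximum_principle
    (nx ny : ℕ) (hnx : Odd nx) (hny : Odd ny) (hnx3 : 3 ≤ nx) (hny3 : 3 ≤ ny)
    (h μ Δt : ℝ) (hh : 0 < h) (hμ : 0 < μ) (hΔt : 0 < Δt)
    (u v : ℕ → ℕ → ℝ) (m a : ℝ)
    (hm : IsGreatest {x : ℝ | ∃ i j : ℕ, 1 ≤ i ∧ i ≤ nx ∧ 1 ≤ j ∧ j ≤ ny ∧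
      x = max |u i j| |v i j|} m)
    (ha : a = h / (2 * μ) * m)
    (ha' : a < (Real.sqrt 201 - 11) / 16)
    (hdt : Δt * μ / h ^ 2 ≥ (2 * a + 1) / (5 / 2 - 11 * a - 8 * a ^ 2))
    (b : Fin (nx + 2) → Fin (ny + 2) → ℝ) :
    (∃! φ : Fin (nx + 2) → Fin (ny + 2) → ℝ,
        schemeA2D nx ny h μ Δt u v φ = fun I J => h ^ 2 / (μ * Δt) * b I J) ∧
      ∀ φ : Fin (nx + 2) → Fin (ny + 2) → ℝ,
        (schemeA2D nx ny h μ Δt u v φ = fun I J => h ^ 2 / (μ * Δt) * b I J) →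
        ∀ I J,
          Finset.univ.inf' ⟨((0 : Fin (nx + 2)), (0 : Fin (ny + 2))), Finset.mem_univ _⟩
              (fun p => b p.1 p.2) ≤ φ I J ∧
            φ I J ≤
              Finset.univ.sup' ⟨((0 : Fin (nx + 2)), (0 : Fin (ny + 2))), Finset.mem_univ _⟩
                (fun p => b p.1 p.2) := by
  have P := SchemeA2D.admissible hnx hny hh hμ hΔt hm ha ha' hdt
  have hc := P.scale_pos.le
  refine ⟨?_, fun φ hφ I J => ⟨?_, ?_⟩⟩
  · exact Function.Bijective.existsUnique
      ⟨P.operator_injective, LinearMap.injective_iff_surjective.1 P.operator_injective⟩ _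
  · refine P.le_of_operator_le (φ := fun _ _ => _) (χ := φ) ?_ I J
    rw [SchemeA2D.operator_const hnx hny, SchemeA2D.operator_apply, hφ]
    exact fun K L => mul_le_mul_of_nonneg_left
      (Finset.inf'_le (fun p : Fin (nx + 2) × Fin (ny + 2) => b p.1 p.2)
        (Finset.mem_univ (K, L))) hc
  · refine P.le_of_operator_le (φ := φ) (χ := fun _ _ => _) ?_ I J
    rw [SchemeA2D.operator_const hnx hny, SchemeA2D.operator_apply, hφ]
    exact fun K L => mul_le_mul_of_nonneg_left
      (Finset.le_sup' (fun p : Fin (nx + 2) × Fin (ny + 2) => b p.1 p.2)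
        (Finset.mem_univ (K, L))) hc
end
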